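/- Let ϑ_P be a primitive recognisable random substitution of constant length ℓ with uniform probabilities (P[ϑ_P(a) = s] = 1/#ϑ(a) for all a ∈ A and s ∈ ϑ(a)), satisfying either (i) ϑ(a) has the same cardinality for all a ∈ A, or (ii) ϑ_P is compatible and ℓ is the only non-zero eigenvalue of the substitution matrix, and let μ_P be the corresponding frequency measure. Then there exist constants c_1, c_2 > 0 such that for all a ∈ A, m ∈ N and w ∈ ϑ^m(a), (c_1/|w|)·e^{−|w|·h_top(X_ϑ)} ≤ μ_P([w]) ≤ (c_2/|w|)·e^{−|w|·h_top(X_ϑ)}. -/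

import Mathlib

open Filter MeasureTheory

namespace RandomSubstitutionTheory

variable {A : Type*} [Fintype A] [DecidableEq A]

/-- The set of realisations of `ϑ(u)` for a word `u`. -/
def reals (θ : A → Finset (List A)) : List A → Finset (List A)
  | [] => {[]}
  | a :: u => (θ a).biUnion fun v => (reals θ u).image fun w => v ++ w

/-- The set of realisations of `ϑ^n(u)` for a word `u`. -/
def realsIter (θ : A → Finset (List A)) : ℕ → List A → Finset (List A)
  | 0, u => {u}
  | n + 1, u => (reals θ u).biUnion fun v => realsIter θ n v

/-- `wordProb θ P u w` is the probability `P[ϑ_P(u) = w]`, each letter of `u` being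
substituted independently. -/
noncomputable def wordProb (θ : A → Finset (List A)) (P : A → List A → ℝ) :
    List A → List A → ℝ
  | [], w => if w = [] then 1 else 0
  | a :: u, w =>
      ∑ v ∈ θ a, P a v * (if v <+: w then wordProb θ P u (w.drop v.length) else 0)

/-- `iterProb θ P n u w` is the probability `P[ϑ_P^n(u) = w]` of the induced Markov chain. -/
noncomputable def iterProb (θ : A → Finset (List A)) (P : A → List A → ℝ) :
    ℕ → List A → List A → ℝ
  | 0, u, w => if u = w then 1 else 0
  | n + 1, u, w => ∑ v ∈ reals θ u, wordProb θ P u v * iterProb θ P n v w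

/-- The substitution matrix `M_{ij} = E[|ϑ_P(a_j)|_{a_i}]`. -/
noncomputable def substM (θ : A → Finset (List A)) (P : A → List A → ℝ) :
    Matrix A A ℝ :=
  Matrix.of fun i j => ∑ w ∈ θ j, P j w * (w.count i : ℝ)

/-- The defining data of a random substitution: nonempty finite sets of nonempty words
and strictly positive probability vectors. -/
def IsRandomSubstitution (θ : A → Finset (List A)) (P : A → List A → ℝ) : Prop :=
  (∀ a, (θ a).Nonempty) ∧ (∀ a, ∀ w ∈ θ a, w ≠ []) ∧
    (∀ a, ∀ w ∈ θ a, 0 < P a w) ∧ (∀ a w, w ∉ θ a → P a w = 0) ∧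
    ∀ a, ∑ w ∈ θ a, P a w = 1

/-- Primitivity of the substitution matrix: some power has strictly positive entries. -/
def IsPrimitive (θ : A → Finset (List A)) (P : A → List A → ℝ) : Prop :=
  ∃ k : ℕ, ∀ i j : A, 0 < (substM θ P ^ k) i j

/-- The Perron–Frobenius eigenvalue is `> 1` (witnessed by a positive right eigenvector). -/
def IsExpanding (θ : A → Finset (List A)) (P : A → List A → ℝ) : Prop :=
  ∃ lam : ℝ, 1 < lam ∧ ∃ R : A → ℝ, (∀ a, 0 < R a) ∧ (substM θ P).mulVec R = lam • R

/-- A word is legal if it occurs as a subword of some level-`k` inflation word. -/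
def Legal (θ : A → Finset (List A)) (u : List A) : Prop :=
  ∃ (a : A) (k : ℕ) (w : List A), w ∈ realsIter θ k [a] ∧ u <:+: w

/-- All words of length `n` over the alphabet. -/
def allWords (A : Type*) [Fintype A] [DecidableEq A] (n : ℕ) : Finset (List A) :=
  (Finset.univ : Finset (Fin n → A)).image List.ofFn

/-- All legal words of length `n`. -/
noncomputable def legalWords (θ : A → Finset (List A)) (n : ℕ) : Finset (List A) :=
  letI := Classical.decPred (Legal θ)
  (allWords A n).filter (Legal θ)

/-- The left shift on bi-infinite sequences. -/
def shift : (ℤ → A) → ℤ → A := fun x i => x (i + 1)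

/-- The finite word of length `n` read off a bi-infinite sequence starting at position `m`. -/
def window (x : ℤ → A) (m : ℤ) (n : ℕ) : List A :=
  (List.range n).map fun t => x (m + (t : ℤ))

/-- The random substitution subshift `X_ϑ`. -/
def Xtheta (θ : A → Finset (List A)) : Set (ℤ → A) :=
  {x | ∀ (m : ℤ) (n : ℕ), Legal θ (window x m n)}

/-- The cylinder set of the word `v` at position `m`. -/
def cylinder (v : List A) (m : ℤ) : Set (ℤ → A) :=
  {x | window x m v.length = v}

/-- The number `|w|_v` of (possibly overlapping) occurrences of `v` in `w`. -/
def occCount (v w : List A) : ℕ :=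
  ((List.range w.length).filter fun i => decide (v <+: w.drop i)).length

/-- Expected length `E[|ϑ_P^k(a)|]`. -/
noncomputable def expLen (θ : A → Finset (List A)) (P : A → List A → ℝ)
    (k : ℕ) (a : A) : ℝ :=
  ∑ w ∈ realsIter θ k [a], iterProb θ P k [a] w * (w.length : ℝ)

/-- Expected number of occurrences `E[|ϑ_P^k(a)|_v]`. -/
noncomputable def expCount (θ : A → Finset (List A)) (P : A → List A → ℝ)
    (k : ℕ) (a : A) (v : List A) : ℝ :=
  ∑ w ∈ realsIter θ k [a], iterProb θ P k [a] w * (occCount v w : ℝ)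

/-- `μ` is the frequency measure of `(ϑ, P)`: a shift-invariant Borel probability measure
supported on `X_ϑ` whose cylinder values are the expected word frequencies. -/
def IsFrequencyMeasure [MeasurableSpace A] (θ : A → Finset (List A))
    (P : A → List A → ℝ) (μ : Measure (ℤ → A)) : Prop :=
  IsProbabilityMeasure μ ∧
    (∀ s : Set (ℤ → A), MeasurableSet s → μ (shift ⁻¹' s) = μ s) ∧
    μ (Xtheta θ) = 1 ∧
    ∀ v : List A, Legal θ v → ∀ (m : ℤ) (a : A),
      Tendsto (fun k : ℕ => expCount θ P k a v / expLen θ P k a) atTop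
        (nhds ((μ (cylinder v m)).toReal))

/-- The `n`-th entropy sum `∑_{u ∈ L_ϑ^n} -μ[u] log μ[u]`. -/
noncomputable def entropySeq [MeasurableSpace A] (θ : A → Finset (List A))
    (μ : Measure (ℤ → A)) (n : ℕ) : ℝ :=
  ∑ u ∈ legalWords θ n, Real.negMulLog ((μ (cylinder u 0)).toReal)

/-- The measure-theoretic (Kolmogorov–Sinai) entropy of the shift with respect to `μ`,
computed along cylinder partitions. -/
noncomputable def measEntropy [MeasurableSpace A] (θ : A → Finset (List A))
    (μ : Measure (ℤ → A)) : ℝ :=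
  limsup (fun n : ℕ => entropySeq θ μ n / (n : ℝ)) atTop

/-- The topological entropy of the subshift `X_ϑ`. -/
noncomputable def topEntropy (θ : A → Finset (List A)) : ℝ :=
  limsup (fun n : ℕ => Real.log ((legalWords θ n).card) / (n : ℝ)) atTop

/-- The entropy vector `H_{k,a} = H(ϑ_P^k(a))`. -/
noncomputable def Hvec (θ : A → Finset (List A)) (P : A → List A → ℝ)
    (k : ℕ) (a : A) : ℝ :=
  ∑ w ∈ realsIter θ k [a], Real.negMulLog (iterProb θ P k [a] w)

/-- The inner product `H_k^T R`. -/
noncomputable def HdotR (θ : A → Finset (List A)) (P : A → List A → ℝ)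
    (R : A → ℝ) (k : ℕ) : ℝ :=
  ∑ a, Hvec θ P k a * R a

/-- Binary entropy `H(p) = -p log p - (1-p) log (1-p)`. -/
noncomputable def binEnt (p : ℝ) : ℝ := Real.negMulLog p + Real.negMulLog (1 - p)

/-- Unique realisation paths: concatenation of level-`k` inflation words of the letters of a
legal word is injective. -/
def UniqueRealisationPaths (θ : A → Finset (List A)) : Prop :=
  ∀ v : List A, Legal θ v → ∀ k : ℕ, ∀ f g : Fin v.length → List A,
    (∀ i, f i ∈ realsIter θ k [v.get i]) → (∀ i, g i ∈ realsIter θ k [v.get i]) →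
      (List.ofFn f).flatten = (List.ofFn g).flatten → f = g

/-- The disjoint set condition. -/
def DisjointSetCondition (θ : A → Finset (List A)) : Prop :=
  ∀ (a : A) (k : ℕ), ∀ u ∈ θ a, ∀ v ∈ θ a, u ≠ v →
    ∀ w, w ∈ realsIter θ k u → w ∉ realsIter θ k v

/-- The identical set condition. -/
def IdenticalSetCondition (θ : A → Finset (List A)) : Prop :=
  ∀ (a : A) (k : ℕ), ∀ u ∈ θ a, ∀ v ∈ θ a, realsIter θ k u = realsIter θ k v

/-- Identical production probabilities. -/
def IdenticalProductionProbabilities (θ : A → Finset (List A))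
    (P : A → List A → ℝ) : Prop :=
  ∀ a : A, ∀ u ∈ θ a, ∀ v ∈ θ a, ∀ (k : ℕ) (w : List A),
    iterProb θ P k u w = iterProb θ P k v w

/-- The disjoint set condition for the `k`-th power `ϑ^k`. -/
def DisjointSetConditionPow (θ : A → Finset (List A)) (k : ℕ) : Prop :=
  ∀ (a : A) (j : ℕ), ∀ u ∈ realsIter θ k [a], ∀ v ∈ realsIter θ k [a], u ≠ v →
    ∀ w, w ∈ realsIter θ (k * j) u → w ∉ realsIter θ (k * j) v

/-- The identical set condition for the `k`-th power `ϑ^k`. -/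
def IdenticalSetConditionPow (θ : A → Finset (List A)) (k : ℕ) : Prop :=
  ∀ (a : A) (j : ℕ), ∀ u ∈ realsIter θ k [a], ∀ v ∈ realsIter θ k [a],
    realsIter θ (k * j) u = realsIter θ (k * j) v

/-- Identical production probabilities for the `k`-th power `ϑ^k`. -/
def IdenticalProductionProbabilitiesPow (θ : A → Finset (List A))
    (P : A → List A → ℝ) (k : ℕ) : Prop :=
  ∀ a : A, ∀ u ∈ realsIter θ k [a], ∀ v ∈ realsIter θ k [a], ∀ (j : ℕ) (w : List A),
    iterProb θ P (k * j) u w = iterProb θ P (k * j) v w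

/-- Compatibility: all realisations of a letter have the same abelianisation. -/
def Compatible (θ : A → Finset (List A)) : Prop :=
  ∀ a : A, ∀ u ∈ θ a, ∀ v ∈ θ a, ∀ b : A, u.count b = v.count b

/-- Constant length `ℓ ≥ 2`. -/
def ConstantLength (θ : A → Finset (List A)) (ℓ : ℕ) : Prop :=
  2 ≤ ℓ ∧ ∀ a : A, ∀ w ∈ θ a, w.length = ℓ

/-- The set `ϑ(y)` of bi-infinite sequences obtained by substituting each letter of `y`,
with the image of `y 0` beginning at position `0`. -/
def substSeq (θ : A → Finset (List A)) (y : ℤ → A) : Set (ℤ → A) :=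
  {x | ∃ v : ℤ → List A, (∀ j, v j ∈ θ (y j)) ∧
    ∃ p : ℤ → ℤ, p 0 = 0 ∧ (∀ j, p (j + 1) = p j + (v j).length) ∧
      ∀ (j : ℤ) (t : ℕ) (ht : t < (v j).length), x (p j + (t : ℤ)) = (v j).get ⟨t, ht⟩}

/-- `ϑ(X)` for a set of bi-infinite sequences. -/
def substImage (θ : A → Finset (List A)) (X : Set (ℤ → A)) : Set (ℤ → A) :=
  ⋃ y ∈ X, substSeq θ y

/-- The set `ϑ^m(y)` of bi-infinite sequences. -/
def substSeqPow (θ : A → Finset (List A)) : ℕ → (ℤ → A) → Set (ℤ → A)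
  | 0, y => {y}
  | m + 1, y => ⋃ z ∈ substSeq θ y, substSeqPow θ m z

/-- The maximal length of an inflation word of the letter `a` (equals the common length
when lengths are well-defined). -/
def maxLen (θ : A → Finset (List A)) (a : A) : ℕ := (θ a).sup List.length

/-- Recognisability: every `x ∈ X_ϑ` has a unique inflation-word decomposition. -/
def Recognisable (θ : A → Finset (List A)) : Prop :=
  ∀ x ∈ Xtheta θ, ∃! p : (ℤ → A) × ℕ,
    p.1 ∈ Xtheta θ ∧ p.2 < maxLen θ (p.1 0) ∧
      (fun i => x (i - (p.2 : ℤ))) ∈ substSeq θ p.1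

/-- Recognisability of the `m`-th power of a constant length-`ℓ` substitution. -/
def RecognisablePow (θ : A → Finset (List A)) (m ℓ : ℕ) : Prop :=
  ∀ x ∈ Xtheta θ, ∃! p : (ℤ → A) × ℕ,
    p.1 ∈ Xtheta θ ∧ p.2 < ℓ ^ m ∧
      (fun i => x (i - (p.2 : ℤ))) ∈ substSeqPow θ m p.1

/-- The set `ϑ^m([a])` of exact images of sequences in the cylinder `[a] ⊆ X_ϑ`. -/
def inflCylPow (θ : A → Finset (List A)) (m : ℕ) (a : A) : Set (ℤ → A) :=
  ⋃ y ∈ {w ∈ Xtheta θ | w 0 = a}, substSeqPow θ m y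

/-- `r` is a radius of local recognisability for `ϑ^m`. -/
def RecogPropPow (θ : A → Finset (List A)) (m r : ℕ) : Prop :=
  ∀ (a : A) (x : ℤ → A), x ∈ inflCylPow θ m a → ∀ y ∈ Xtheta θ,
    (∀ t : ℤ, -(r : ℤ) ≤ t → t ≤ (r : ℤ) → x t = y t) → y ∈ inflCylPow θ m a

/-- The recognisability radius `κ(ϑ^m)`. -/
noncomputable def recogRadiusPow (θ : A → Finset (List A)) (m : ℕ) : ℕ :=
  sInf {r | RecogPropPow θ m r}

/-- The recognisability radius `κ(ϑ)`. -/
noncomputable def recogRadius (θ : A → Finset (List A)) : ℕ := recogRadiusPow θ 1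

/-- The random word `ϑ_P^n(a)` is (a.s.) completely determined by `ϑ_P^{n+k}(a)`
in the Markov chain. -/
def DeterminedBy (θ : A → Finset (List A)) (P : A → List A → ℝ)
    (a : A) (n k : ℕ) : Prop :=
  ∀ v₁ v₂ w : List A, v₁ ∈ realsIter θ n [a] → v₂ ∈ realsIter θ n [a] →
    0 < iterProb θ P n [a] v₁ * iterProb θ P k v₁ w →
      0 < iterProb θ P n [a] v₂ * iterProb θ P k v₂ w → v₁ = v₂

/-- The random words `ϑ_P^n(a)` and `ϑ_P^{n+k}(a)` are independent in the Markov chain. -/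
def IndepSteps (θ : A → Finset (List A)) (P : A → List A → ℝ)
    (a : A) (n k : ℕ) : Prop :=
  ∀ v w : List A,
    iterProb θ P n [a] v * iterProb θ P k v w =
      iterProb θ P n [a] v * iterProb θ P (n + k) [a] w

/-- The substitution matrix of a marginal (deterministic) substitution. -/
def marginalM (ρ : A → List A) : Matrix A A ℝ :=
  Matrix.of fun i j => ((ρ j).count i : ℝ)

/-- Geometric compatibility: a single positive left eigenvector with eigenvalue `λ > 1`
for all marginals. -/
def GeometricallyCompatible (θ : A → Finset (List A)) : Prop :=
  ∃ lam : ℝ, 1 < lam ∧ ∃ L : A → ℝ, (∀ a, 0 < L a) ∧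
    ∀ ρ : A → List A, (∀ a, ρ a ∈ θ a) → Matrix.vecMul L (marginalM ρ) = lam • L


set_option linter.unusedSectionVars false

section Words

variable {θ : A → Finset (List A)}

lemma mem_reals_cons {a : A} {u x : List A} :
    x ∈ reals θ (a :: u) ↔ ∃ y ∈ θ a, ∃ z ∈ reals θ u, y ++ z = x := by
  simp [reals]

lemma mem_reals_append {u v x : List A} :
    x ∈ reals θ (u ++ v) ↔ ∃ y ∈ reals θ u, ∃ z ∈ reals θ v, y ++ z = x := by
  induction u generalizing x with
  | nil => simp [reals]
  | cons a u ih =>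
    simp only [List.cons_append, mem_reals_cons, ih]
    constructor
    · rintro ⟨y, hy, _, ⟨z, hz, t, ht, rfl⟩, rfl⟩
      exact ⟨y ++ z, ⟨y, hy, z, hz, rfl⟩, t, ht, by simp⟩
    · rintro ⟨_, ⟨y, hy, z, hz, rfl⟩, t, ht, rfl⟩
      exact ⟨y, hy, z ++ t, ⟨z, hz, t, ht, rfl⟩, by simp⟩

lemma mem_realsIter_succ {n : ℕ} {u x : List A} :
    x ∈ realsIter θ (n + 1) u ↔ ∃ v ∈ reals θ u, x ∈ realsIter θ n v := by
  simp [realsIter]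

lemma mem_realsIter_append {n : ℕ} {u v x : List A} :
    x ∈ realsIter θ n (u ++ v) ↔
      ∃ y ∈ realsIter θ n u, ∃ z ∈ realsIter θ n v, y ++ z = x := by
  induction n generalizing u v x with
  | zero => simp [realsIter, eq_comm]
  | succ n ih =>
    simp only [mem_realsIter_succ, mem_reals_append]
    constructor
    · rintro ⟨_, ⟨y, hy, z, hz, rfl⟩, hx⟩
      obtain ⟨s, hs, t, ht, rfl⟩ := ih.1 hx
      exact ⟨s, ⟨y, hy, hs⟩, t, ⟨z, hz, ht⟩, rfl⟩
    · rintro ⟨s, ⟨y, hy, hs⟩, t, ⟨z, hz, ht⟩, rfl⟩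
      exact ⟨y ++ z, ⟨y, hy, z, hz, rfl⟩, ih.2 ⟨s, hs, t, ht, rfl⟩⟩

lemma mem_realsIter_add {m n : ℕ} {u x : List A} :
    x ∈ realsIter θ (m + n) u ↔ ∃ v ∈ realsIter θ m u, x ∈ realsIter θ n v := by
  induction m generalizing u x with
  | zero => simp [realsIter]
  | succ m ih =>
    rw [show m + 1 + n = m + n + 1 by ring]
    simp only [mem_realsIter_succ, ih]
    constructor
    · rintro ⟨v, hv, y, hy, hx⟩
      exact ⟨y, ⟨v, hv, hy⟩, hx⟩
    · rintro ⟨y, ⟨v, hv, hy⟩, hx⟩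
      exact ⟨v, hv, y, hy, hx⟩

lemma mem_realsIter_one {u x : List A} : x ∈ realsIter θ 1 u ↔ x ∈ reals θ u := by
  simp [realsIter]

lemma mem_realsIter_succ_right {n : ℕ} {u x : List A} :
    x ∈ realsIter θ (n + 1) u ↔ ∃ v ∈ realsIter θ n u, x ∈ reals θ v := by
  simp [mem_realsIter_add, mem_realsIter_one]

lemma eq_nil_of_mem_realsIter_nil {n : ℕ} {x : List A} (hx : x ∈ realsIter θ n []) :
    x = [] := by
  induction n generalizing x with
  | zero => simpa [realsIter] using hx
  | succ n ih =>
    obtain ⟨v, hv, hx⟩ := mem_realsIter_succ.1 hx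
    obtain rfl : v = [] := by simpa [reals] using hv
    exact ih hx

lemma reals_nonempty (hθ : ∀ a, (θ a).Nonempty) (u : List A) : (reals θ u).Nonempty := by
  induction u with
  | nil => simp [reals]
  | cons a u ih =>
    obtain ⟨y, hy⟩ := hθ a
    obtain ⟨z, hz⟩ := ih
    exact ⟨y ++ z, mem_reals_cons.2 ⟨y, hy, z, hz, rfl⟩⟩

lemma realsIter_nonempty (hθ : ∀ a, (θ a).Nonempty) (n : ℕ) (u : List A) :
    (realsIter θ n u).Nonempty := by
  induction n generalizing u with
  | zero => simp [realsIter]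
  | succ n ih =>
    obtain ⟨v, hv⟩ := reals_nonempty hθ u
    obtain ⟨x, hx⟩ := ih v
    exact ⟨x, mem_realsIter_succ.2 ⟨v, hv, hx⟩⟩

lemma ConstantLength.length_reals {ℓ : ℕ} (hcl : ConstantLength θ ℓ) {u x : List A}
    (hx : x ∈ reals θ u) : x.length = ℓ * u.length := by
  induction u generalizing x with
  | nil => simp_all [reals]
  | cons a u ih =>
    obtain ⟨y, hy, z, hz, rfl⟩ := mem_reals_cons.1 hx
    rw [List.length_append, hcl.2 a y hy, ih hz, List.length_cons]
    ring

lemma ConstantLength.length_realsIter {ℓ : ℕ} (hcl : ConstantLength θ ℓ) {n : ℕ}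
    {u x : List A} (hx : x ∈ realsIter θ n u) : x.length = ℓ ^ n * u.length := by
  induction n generalizing u with
  | zero => simp_all [realsIter]
  | succ n ih =>
    obtain ⟨v, hv, hx⟩ := mem_realsIter_succ.1 hx
    rw [ih hx, hcl.length_reals hv]
    ring

lemma ConstantLength.take_drop_mem {ℓ : ℕ} (hcl : ConstantLength θ ℓ) {u x : List A}
    (hx : x ∈ reals θ u) (j : ℕ) (hj : j < u.length) :
    (x.drop (ℓ * j)).take ℓ ∈ θ u[j] := by
  induction u generalizing x j with
  | nil => simp at hj
  | cons a u ih =>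
    obtain ⟨y, hy, z, hz, rfl⟩ := mem_reals_cons.1 hx
    have hl := hcl.2 a y hy
    cases j with
    | zero => simpa [← hl] using hy
    | succ j =>
      have := ih hz j (by simpa using hj)
      rw [Nat.mul_succ, Nat.add_comm (ℓ * j), ← List.drop_drop, ← hl, List.drop_left, hl]
      simpa using this

lemma Legal.of_infix {u v : List A} (hv : Legal θ v) (h : u <:+: v) : Legal θ u := by
  obtain ⟨a, k, w, hw, hvw⟩ := hv
  exact ⟨a, k, w, hw, h.trans hvw⟩

lemma Legal.of_mem_realsIter (hθ : ∀ a, (θ a).Nonempty) {u x : List A} {n : ℕ}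
    (hu : Legal θ u) (hx : x ∈ realsIter θ n u) : Legal θ x := by
  obtain ⟨a, k, w, hw, s, t, rfl⟩ := hu
  obtain ⟨s', hs⟩ := realsIter_nonempty hθ n s
  obtain ⟨t', ht⟩ := realsIter_nonempty hθ n t
  refine ⟨a, k + n, s' ++ x ++ t', mem_realsIter_add.2 ⟨_, hw, ?_⟩, s', t', rfl⟩
  exact mem_realsIter_append.2 ⟨_, mem_realsIter_append.2 ⟨s', hs, x, hx, rfl⟩, t', ht, rfl⟩

lemma legal_of_mem_realsIter {a : A} {x : List A} {n : ℕ} (hx : x ∈ realsIter θ n [a]) :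
    Legal θ x :=
  ⟨a, n, x, hx, List.infix_rfl⟩

end Words

section Expectation

variable {θ : A → Finset (List A)} {P : A → List A → ℝ}

/-- The Markov operator of a random substitution: `markov θ P F u = E[F (ϑ_P(u))]`. -/
noncomputable def markov (θ : A → Finset (List A)) (P : A → List A → ℝ)
    (F : List A → ℝ) (u : List A) : ℝ :=
  ∑ v ∈ reals θ u, wordProb θ P u v * F v

lemma wordProb_eq_zero {u w : List A} (hw : w ∉ reals θ u) : wordProb θ P u w = 0 := by
  induction u generalizing w with
  | nil => simpa [wordProb, reals] using hw
  | cons a u ih =>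
    rw [wordProb]
    refine Finset.sum_eq_zero fun v hv => ?_
    split_ifs with h
    · obtain ⟨t, rfl⟩ := h
      rw [List.drop_left, ih fun ht => hw (mem_reals_cons.2 ⟨v, hv, t, ht, rfl⟩), mul_zero]
    · simp

lemma IsRandomSubstitution.nonneg (h : IsRandomSubstitution θ P) {a : A} {v : List A}
    (hv : v ∈ θ a) : 0 ≤ P a v :=
  (h.2.2.1 a v hv).le

lemma wordProb_nonneg (h : IsRandomSubstitution θ P) (u w : List A) :
    0 ≤ wordProb θ P u w := by
  induction u generalizing w with
  | nil => rw [wordProb]; split_ifs <;> simp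
  | cons a u ih =>
    rw [wordProb]
    refine Finset.sum_nonneg fun v hv => mul_nonneg (h.nonneg hv) ?_
    split_ifs
    · exact ih _
    · exact le_rfl

lemma markov_nil (F : List A → ℝ) : markov θ P F [] = F [] := by
  simp [markov, reals, wordProb]

lemma markov_cons (F : List A → ℝ) (a : A) (u : List A) :
    markov θ P F (a :: u) = ∑ v ∈ θ a, P a v * markov θ P (fun w => F (v ++ w)) u := by
  simp only [markov, wordProb, Finset.sum_mul]
  rw [Finset.sum_comm]
  refine Finset.sum_congr rfl fun v hv => ?_
  rw [Finset.mul_sum]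
  have hsub : (reals θ u).image (fun w => v ++ w) ⊆ reals θ (a :: u) := by
    intro x hx
    obtain ⟨w, hw, rfl⟩ := Finset.mem_image.1 hx
    exact mem_reals_cons.2 ⟨v, hv, w, hw, rfl⟩
  rw [← Finset.sum_subset hsub, Finset.sum_image fun x _ y _ h => List.append_cancel_left h]
  · exact Finset.sum_congr rfl fun w _ => by simp; ring
  · intro x _ hx
    split_ifs with h
    · obtain ⟨t, rfl⟩ := h
      rw [List.drop_left, wordProb_eq_zero fun ht => hx (Finset.mem_image_of_mem _ ht)]
      simp
    · simp

lemma markov_append (F : List A → ℝ) (u v : List A) :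
    markov θ P F (u ++ v) = markov θ P (fun x => markov θ P (fun y => F (x ++ y)) v) u := by
  induction u generalizing F with
  | nil => simp [markov_nil]
  | cons a u ih => simp [markov_cons, ih]

lemma markov_sum {ι : Type*} (s : Finset ι) (c : ι → ℝ) (G : ι → List A → ℝ) :
    markov θ P (fun x => ∑ i ∈ s, c i * G i x) =
      fun u => ∑ i ∈ s, c i * markov θ P (G i) u := by
  ext u
  simp only [markov, Finset.mul_sum]
  rw [Finset.sum_comm]
  exact Finset.sum_congr rfl fun _ _ => Finset.sum_congr rfl fun _ _ => by ring

lemma markov_iterate_sum {ι : Type*} (n : ℕ) (s : Finset ι) (c : ι → ℝ)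
    (G : ι → List A → ℝ) :
    (markov θ P)^[n] (fun x => ∑ i ∈ s, c i * G i x) =
      fun u => ∑ i ∈ s, c i * (markov θ P)^[n] (G i) u := by
  induction n generalizing G with
  | zero => rfl
  | succ n ih => simp only [Function.iterate_succ_apply, markov_sum, ih]

lemma markov_iterate_append (n : ℕ) (F : List A → ℝ) (u v : List A) :
    (markov θ P)^[n] F (u ++ v) =
      (markov θ P)^[n] (fun x => (markov θ P)^[n] (fun y => F (x ++ y)) v) u := by
  induction n generalizing F u v with
  | zero => rfl
  | succ n ih =>
    simp only [Function.iterate_succ_apply', markov_append, ih]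
    congr 1
    ext x
    unfold markov
    exact (congrFun (markov_iterate_sum n _ _ _) x).symm

lemma markov_iterate_nil (n : ℕ) (F : List A → ℝ) : (markov θ P)^[n] F [] = F [] := by
  induction n generalizing F with
  | zero => rfl
  | succ n ih => rw [Function.iterate_succ_apply, ih, markov_nil]

lemma markov_mono (h : IsRandomSubstitution θ P) {F G : List A → ℝ} {u : List A}
    (hFG : ∀ v ∈ reals θ u, F v ≤ G v) : markov θ P F u ≤ markov θ P G u :=
  Finset.sum_le_sum fun v hv => mul_le_mul_of_nonneg_left (hFG v hv) (wordProb_nonneg h u v)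

lemma markov_iterate_mono (h : IsRandomSubstitution θ P) {n : ℕ} {F G : List A → ℝ}
    {u : List A} (hFG : ∀ v ∈ realsIter θ n u, F v ≤ G v) :
    (markov θ P)^[n] F u ≤ (markov θ P)^[n] G u := by
  induction n generalizing u with
  | zero => exact hFG u (by simp [realsIter])
  | succ n ih =>
    rw [Function.iterate_succ_apply', Function.iterate_succ_apply']
    exact markov_mono h fun v hv => ih fun w hw => hFG w (mem_realsIter_succ.2 ⟨v, hv, hw⟩)

lemma markov_iterate_congr (h : IsRandomSubstitution θ P) {n : ℕ} {F G : List A → ℝ}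
    {u : List A} (hFG : ∀ v ∈ realsIter θ n u, F v = G v) :
    (markov θ P)^[n] F u = (markov θ P)^[n] G u :=
  le_antisymm (markov_iterate_mono h fun v hv => (hFG v hv).le)
    (markov_iterate_mono h fun v hv => (hFG v hv).ge)

lemma markov_const (h : IsRandomSubstitution θ P) (c : ℝ) (u : List A) :
    markov θ P (fun _ => c) u = c := by
  induction u with
  | nil => exact markov_nil _
  | cons a u ih => simp [markov_cons, ih, ← Finset.sum_mul, h.2.2.2.2 a]

lemma markov_iterate_const (h : IsRandomSubstitution θ P) (n : ℕ) (c : ℝ) (u : List A) :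
    (markov θ P)^[n] (fun _ => c) u = c := by
  induction n with
  | zero => rfl
  | succ n ih =>
    rw [Function.iterate_succ_apply, show markov θ P (fun _ => c) = fun _ => c from
      funext fun u => markov_const h c u, ih]

lemma markov_iterate_const_mul (n : ℕ) (c : ℝ) (F : List A → ℝ) (u : List A) :
    (markov θ P)^[n] (fun x => c * F x) u = c * (markov θ P)^[n] F u := by
  simpa using congrFun (markov_iterate_sum (θ := θ) (P := P) n {()} (fun _ => c) fun _ => F) u

lemma markov_iterate_add (n : ℕ) (F G : List A → ℝ) (u : List A) :
    (markov θ P)^[n] (fun x => F x + G x) u =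
      (markov θ P)^[n] F u + (markov θ P)^[n] G u := by
  simpa using congrFun (markov_iterate_sum (θ := θ) (P := P) n Finset.univ (fun _ => 1)
    fun b : Bool => if b then F else G) u

lemma iterProb_eq_zero {n : ℕ} {u w : List A} (hw : w ∉ realsIter θ n u) :
    iterProb θ P n u w = 0 := by
  induction n generalizing u with
  | zero =>
    rw [iterProb, if_neg]
    rintro rfl
    simp [realsIter] at hw
  | succ n ih =>
    rw [iterProb]
    refine Finset.sum_eq_zero fun v hv => ?_
    rw [ih fun h => hw (mem_realsIter_succ.2 ⟨v, hv, h⟩), mul_zero]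

lemma sum_iterProb_mul (n : ℕ) (F : List A → ℝ) (u : List A) :
    ∑ w ∈ realsIter θ n u, iterProb θ P n u w * F w = (markov θ P)^[n] F u := by
  induction n generalizing u with
  | zero => simp [realsIter, iterProb]
  | succ n ih =>
    simp only [iterProb, Function.iterate_succ_apply', markov, Finset.sum_mul]
    rw [Finset.sum_comm]
    refine Finset.sum_congr rfl fun v hv => ?_
    have hsub : realsIter θ n v ⊆ realsIter θ (n + 1) u := fun w hw =>
      mem_realsIter_succ.2 ⟨v, hv, hw⟩
    rw [show (markov θ P)^[n] F v = _ from (ih v).symm, Finset.mul_sum,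
      ← Finset.sum_subset hsub]
    · exact Finset.sum_congr rfl fun w _ => by ring
    · intro w _ hw
      rw [iterProb_eq_zero hw]
      ring

/-- The sum of the values of a function on letters along a word. -/
def letterSum (f : A → ℝ) (u : List A) : ℝ := (u.map f).sum

lemma letterSum_nil (f : A → ℝ) : letterSum f [] = 0 := rfl

lemma letterSum_cons (f : A → ℝ) (a : A) (u : List A) :
    letterSum f (a :: u) = f a + letterSum f u := by
  simp [letterSum]

lemma letterSum_append (f : A → ℝ) (u v : List A) :
    letterSum f (u ++ v) = letterSum f u + letterSum f v := by
  simp [letterSum]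

lemma letterSum_singleton (f : A → ℝ) (a : A) : letterSum f [a] = f a := by
  simp [letterSum]

lemma letterSum_const (c : ℝ) (u : List A) : letterSum (fun _ => c) u = u.length * c := by
  simp [letterSum]

lemma letterSum_eq_sum_count (f : A → ℝ) (u : List A) :
    letterSum f u = ∑ b, f b * (u.count b : ℝ) := by
  induction u with
  | nil => simp [letterSum]
  | cons a u ih =>
    simp [letterSum_cons, ih, List.count_cons, mul_add, Finset.sum_add_distrib, add_comm]

lemma vecMul_substM (f : A → ℝ) (a : A) :
    Matrix.vecMul f (substM θ P) a = ∑ w ∈ θ a, P a w * letterSum f w := by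
  simp only [Matrix.vecMul, dotProduct, substM, Matrix.of_apply, letterSum_eq_sum_count,
    Finset.mul_sum]
  rw [Finset.sum_comm]
  exact Finset.sum_congr rfl fun _ _ => Finset.sum_congr rfl fun _ _ => by ring

lemma markov_letterSum (h : IsRandomSubstitution θ P) (f : A → ℝ) :
    markov θ P (letterSum f) = letterSum (Matrix.vecMul f (substM θ P)) := by
  ext u
  induction u with
  | nil => exact markov_nil _
  | cons a u ih =>
    have hadd (v : List A) : markov θ P (fun w => letterSum f (v ++ w)) u =
        letterSum f v + markov θ P (letterSum f) u := by
      simp only [letterSum_append]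
      have := markov_iterate_add (θ := θ) (P := P) 1 (fun _ => letterSum f v) (letterSum f) u
      simpa [markov_const h] using this
    simp only [markov_cons, hadd, ih, letterSum_cons, mul_add, Finset.sum_add_distrib,
      vecMul_substM, ← Finset.sum_mul, h.2.2.2.2 a, one_mul]

lemma markov_iterate_letterSum (h : IsRandomSubstitution θ P) (n : ℕ) (f : A → ℝ) :
    (markov θ P)^[n] (letterSum f) = letterSum (Matrix.vecMul f (substM θ P ^ n)) := by
  induction n generalizing f with
  | zero => simp
  | succ n ih =>
    rw [Function.iterate_succ_apply, markov_letterSum h, ih, Matrix.vecMul_vecMul, pow_succ']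

lemma expCount_eq (n : ℕ) (a : A) (v : List A) :
    expCount θ P n a v = (markov θ P)^[n] (fun w => (occCount v w : ℝ)) [a] :=
  sum_iterProb_mul n _ _

lemma expLen_eq {ℓ : ℕ} (h : IsRandomSubstitution θ P) (hcl : ConstantLength θ ℓ)
    (n : ℕ) (a : A) : expLen θ P n a = (ℓ : ℝ) ^ n := by
  rw [expLen, sum_iterProb_mul n (fun w => (w.length : ℝ)),
    markov_iterate_congr h (G := fun _ => (ℓ : ℝ) ^ n), markov_iterate_const h]
  intro v hv
  simp [hcl.length_realsIter hv]

end Expectation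

section Recognisability

variable {θ : A → Finset (List A)}

lemma exists_eventually_eq_hyperfilter {B : Type*} [Finite B] (f : ℕ → B) :
    ∃ b, ∀ᶠ r in (hyperfilter ℕ : Filter ℕ), f r = b := by
  have h : ∀ᶠ r in (hyperfilter ℕ : Filter ℕ), ∃ b, f r = b := .of_forall fun r => ⟨_, rfl⟩
  exact Ultrafilter.eventually_exists_iff.1 h

lemma window_eq_map (x : ℤ → A) (m : ℤ) (n : ℕ) :
    window x m n = (List.range n).map fun t : ℕ => x (m + (t : ℤ)) := by
  simp [window, List.map_eq_flatMap, List.flatMap_assoc]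

/-- The bi-infinite sequence carrying the word `x`, with the letter at index `c` at the origin,
and the letter `d` outside of `x`. -/
def seqOfWord (d : A) (x : List A) (c : ℕ) : ℤ → A :=
  fun i => x.getD ((c : ℤ) + i).toNat d

lemma window_seqOfWord (d : A) (x : List A) (c : ℕ) (m : ℤ) (s n : ℕ)
    (hs : (c : ℤ) + m = s) (hn : s + n ≤ x.length) :
    window (seqOfWord d x c) m n = (x.drop s).take n := by
  apply List.ext_getElem
  · simp [window_eq_map]; omega
  · intro i h1 h2
    have hi : i < n := by simpa [window_eq_map] using h1
    have : ((c : ℤ) + (m + i)).toNat = s + i := by omega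
    simp only [window_eq_map, List.getElem_map, List.getElem_range, seqOfWord, this,
      List.getElem_take, List.getElem_drop]
    rw [List.getD_eq_getElem _ _ (by omega)]

lemma eventually_window_eq {f : ℕ → ℤ → A} {X : ℤ → A}
    (hX : ∀ i, ∀ᶠ r in (hyperfilter ℕ : Filter ℕ), f r i = X i) (m : ℤ) (n : ℕ) :
    ∀ᶠ r in (hyperfilter ℕ : Filter ℕ), window (f r) m n = window X m n := by
  have h : ∀ᶠ r in (hyperfilter ℕ : Filter ℕ), ∀ t ∈ Finset.range n,
      f r (m + (t : ℤ)) = X (m + (t : ℤ)) :=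
    (Filter.eventually_all_finset _).2 fun t _ => hX _
  filter_upwards [h] with r hr
  rw [window_eq_map, window_eq_map]
  exact List.map_congr_left fun t ht => hr t (by simpa using ht)

lemma eventually_ge_hyperfilter (N : ℕ) : ∀ᶠ r in (hyperfilter ℕ : Filter ℕ), N ≤ r :=
  Nat.hyperfilter_le_atTop (eventually_ge_atTop N)

lemma mem_Xtheta_of_eventually {d : A} {x : ℕ → List A} {c : ℕ → ℕ} {X : ℤ → A}
    (hx : ∀ r, Legal θ (x r))
    (hc : ∀ N : ℕ, ∀ᶠ r in (hyperfilter ℕ : Filter ℕ), N ≤ c r ∧ c r + N ≤ (x r).length)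
    (hX : ∀ i, ∀ᶠ r in (hyperfilter ℕ : Filter ℕ), seqOfWord d (x r) (c r) i = X i) :
    X ∈ Xtheta θ := by
  intro m n
  obtain ⟨r, hr, hr1, hr2⟩ :=
    ((eventually_window_eq hX m n).and (hc (m.natAbs + n))).exists
  rw [← hr, window_seqOfWord d (x r) (c r) m ((c r : ℤ) + m).toNat n (by omega) (by omega)]
  exact (hx r).of_infix ((List.take_prefix _ _).isInfix.trans (List.drop_suffix _ _).isInfix)

lemma ConstantLength.maxLen_eq {ℓ : ℕ} (hcl : ConstantLength θ ℓ)
    (hθ : ∀ a, (θ a).Nonempty) (a : A) : maxLen θ a = ℓ := by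
  rw [maxLen, Finset.sup_congr rfl (hcl.2 a), Finset.sup_const (hθ a)]

lemma mem_substSeq_of_eventually {ℓ : ℕ} (hcl : ConstantLength θ ℓ)
    {d : A} {x u : ℕ → List A} {c : ℕ → ℕ} {k : ℕ} {X U : ℤ → A}
    (hxu : ∀ r, x r ∈ reals θ (u r))
    (hc : ∀ r, r ≤ c r ∧ c r + r < (x r).length)
    (hk : ∀ᶠ r in (hyperfilter ℕ : Filter ℕ), c r % ℓ = k)
    (hX : ∀ i, ∀ᶠ r in (hyperfilter ℕ : Filter ℕ), seqOfWord d (x r) (c r) i = X i)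
    (hU : ∀ i, ∀ᶠ r in (hyperfilter ℕ : Filter ℕ), seqOfWord d (u r) (c r / ℓ) i = U i) :
    (fun i => X (i - (k : ℤ))) ∈ substSeq θ U := by
  have hmem : ∀ j : ℤ, window X (ℓ * j - k) ℓ ∈ θ (U j) := by
    intro j
    obtain ⟨r, hr1, hr2, hr3, hr4⟩ := ((eventually_window_eq hX (ℓ * j - k) ℓ).and
      ((hU j).and (hk.and (eventually_ge_hyperfilter (ℓ * (j.natAbs + 2)))))).exists
    have hlen := hcl.length_reals (hxu r)
    have hℓ := hcl.1
    obtain ⟨hc1, hc2⟩ := hc r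
    have hdm := Nat.div_add_mod (c r) ℓ
    have hkl : k < ℓ := hr3 ▸ Nat.mod_lt _ (by omega)
    rw [hr3] at hdm
    obtain ⟨J, hJ⟩ : ∃ J : ℕ, ((c r / ℓ : ℕ) : ℤ) + j = J := by
      refine ⟨(((c r / ℓ : ℕ) : ℤ) + j).toNat, (Int.toNat_of_nonneg ?_).symm⟩
      have : j.natAbs + 2 ≤ c r / ℓ := (Nat.le_div_iff_mul_le (by omega)).2 (by linarith)
      omega
    have hJlt : J < (u r).length := by
      have h1 : ℓ * (c r / ℓ) + ℓ * (j.natAbs + 2) < ℓ * (u r).length := by omega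
      rw [← Nat.mul_add] at h1
      have := Nat.lt_of_mul_lt_mul_left h1
      omega
    have hb := hcl.take_drop_mem (hxu r) J hJlt
    have hpos : (c r : ℤ) + (ℓ * j - k) = ((ℓ * J : ℕ) : ℤ) := by
      have hdm' : (c r : ℤ) = ℓ * ((c r / ℓ : ℕ) : ℤ) + k := by exact_mod_cast hdm.symm
      rw [Nat.cast_mul, ← hJ, hdm']
      ring
    have hfit : ℓ * J + ℓ ≤ (x r).length := by
      rw [hlen, ← Nat.mul_succ]
      exact Nat.mul_le_mul_left _ hJlt
    rw [← hr1, ← hr2, window_seqOfWord d (x r) (c r) _ _ _ hpos hfit]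
    convert hb using 2
    rw [seqOfWord, hJ, Int.toNat_natCast, List.getD_eq_getElem _ _ hJlt]
  refine ⟨fun j => window X (ℓ * j - k) ℓ, hmem, fun j => ℓ * j, by simp, ?_, ?_⟩
  · intro j
    simp [window_eq_map, mul_add]
  · intro j t ht
    simp only [window_eq_map, List.get_eq_getElem, List.getElem_map, List.getElem_range]
    congr 1
    ring

/-- Local recognisability: a sufficiently long stretch of an inflation word determines the
position of the cut and the letter in the middle. -/
lemma exists_recognisability_radius {ℓ : ℕ} (hθ : ∀ a, (θ a).Nonempty)
    (hcl : ConstantLength θ ℓ) (hrec : Recognisable θ) (d : A) :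
    ∃ r : ℕ, ∀ u v x y : List A, Legal θ u → Legal θ v → x ∈ reals θ u → y ∈ reals θ v →
      ∀ i j : ℕ, i + 2 * r < x.length → j + 2 * r < y.length →
        (∀ t ≤ 2 * r, x[i + t]? = y[j + t]?) →
          (i + r) % ℓ = (j + r) % ℓ ∧ u[(i + r) / ℓ]? = v[(j + r) / ℓ]? := by
  by_contra! hcon
  choose u v x y hu hv hx hy i j hi hj hxy hne using hcon
  have hℓ : 0 < ℓ := by have := hcl.1; omega
  have legal_x (r) : Legal θ (x r) := (hu r).of_mem_realsIter hθ (mem_realsIter_one.2 (hx r))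
  have lim (f : ℕ → ℤ → A) :
      ∃ X : ℤ → A, ∀ t, ∀ᶠ r in (hyperfilter ℕ : Filter ℕ), f r t = X t := by
    choose X hX using fun t => exists_eventually_eq_hyperfilter fun r => f r t
    exact ⟨X, hX⟩
  have limk (c : ℕ → ℕ) : ∃ k < ℓ, ∀ᶠ r in (hyperfilter ℕ : Filter ℕ), c r % ℓ = k := by
    obtain ⟨k, hk⟩ := exists_eventually_eq_hyperfilter
      fun r => (⟨c r % ℓ, Nat.mod_lt _ hℓ⟩ : Fin ℓ)
    exact ⟨k, k.2, hk.mono fun r hr => congrArg Fin.val hr⟩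
  obtain ⟨X, hX⟩ := lim fun r => seqOfWord d (x r) (i r + r)
  obtain ⟨U, hU⟩ := lim fun r => seqOfWord d (u r) ((i r + r) / ℓ)
  obtain ⟨V, hV⟩ := lim fun r => seqOfWord d (v r) ((j r + r) / ℓ)
  obtain ⟨k, hkℓ, hk⟩ := limk fun r => i r + r
  obtain ⟨k', hkℓ', hk'⟩ := limk fun r => j r + r
  have hY : ∀ t, ∀ᶠ r in (hyperfilter ℕ : Filter ℕ),
      seqOfWord d (y r) (j r + r) t = X t := by
    intro t
    filter_upwards [hX t, eventually_ge_hyperfilter t.natAbs] with r hr hrt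
    rw [← hr]
    obtain ⟨s, hs⟩ : ∃ s : ℕ, (r : ℤ) + t = s := ⟨((r : ℤ) + t).toNat, by omega⟩
    have := hxy r s (by omega)
    simp only [seqOfWord, List.getD_eq_getElem?_getD]
    rw [show (((i r + r : ℕ) : ℤ) + t).toNat = i r + s by omega,
      show (((j r + r : ℕ) : ℤ) + t).toNat = j r + s by omega, this]
  have hdiv (z w : ℕ → List A) (c : ℕ → ℕ) (hzw : ∀ r, z r ∈ reals θ (w r))
      (hc : ∀ r, r ≤ c r ∧ c r + r < (z r).length) (N : ℕ) :
      ∀ᶠ r in (hyperfilter ℕ : Filter ℕ), N ≤ c r / ℓ ∧ c r / ℓ + N ≤ (w r).length := by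
    filter_upwards [eventually_ge_hyperfilter (ℓ * N)] with r hr
    obtain ⟨h1, h2⟩ := hc r
    refine ⟨(Nat.le_div_iff_mul_le hℓ).2 (by linarith), ?_⟩
    have h3 := Nat.mul_div_le (c r) ℓ
    have h4 := hcl.length_reals (hzw r)
    have : ℓ * (c r / ℓ + N) ≤ ℓ * (w r).length := by rw [Nat.mul_add]; omega
    exact Nat.le_of_mul_le_mul_left this hℓ
  have hcx (r) : r ≤ i r + r ∧ i r + r + r < (x r).length := by have := hi r; omega
  have hcy (r) : r ≤ j r + r ∧ j r + r + r < (y r).length := by have := hj r; omega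
  have hXX : X ∈ Xtheta θ := by
    refine mem_Xtheta_of_eventually legal_x (fun N => ?_) hX
    filter_upwards [eventually_ge_hyperfilter N] with r hr
    have := hcx r
    omega
  have hUX : U ∈ Xtheta θ := mem_Xtheta_of_eventually hu (hdiv x u _ hx hcx) hU
  have hVX : V ∈ Xtheta θ := mem_Xtheta_of_eventually hv (hdiv y v _ hy hcy) hV
  have heq := (hrec X hXX).unique (y₁ := (U, k)) (y₂ := (V, k'))
    ⟨hUX, by rwa [hcl.maxLen_eq hθ], mem_substSeq_of_eventually hcl hx hcx hk hX hU⟩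
    ⟨hVX, by rwa [hcl.maxLen_eq hθ], mem_substSeq_of_eventually hcl hy hcy hk' hY hV⟩
  obtain ⟨rfl, rfl⟩ := Prod.mk.inj heq
  obtain ⟨r, h1, h2, h3, h4, h5, h6⟩ := (hk.and (hk'.and ((hU 0).and ((hV 0).and
    ((hdiv x u _ hx hcx 1).and (hdiv y v _ hy hcy 1)))))).exists
  refine hne r (h1.trans h2.symm) ?_
  have h7 := h3.trans h4.symm
  simp only [seqOfWord, add_zero, Int.toNat_natCast] at h7
  rw [List.getD_eq_getElem _ _ (by omega), List.getD_eq_getElem _ _ (by omega)] at h7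
  rw [List.getElem?_eq_getElem (by omega), List.getElem?_eq_getElem (by omega), h7]

end Recognisability

section Supertiles

variable {θ : A → Finset (List A)} {P : A → List A → ℝ} {ℓ r : ℕ}

/-- Stretches of length `2 * r + 1` of inflation words of legal words determine the position of
the cut and the letter in the middle. -/
def LocallyRecognisable (θ : A → Finset (List A)) (ℓ r : ℕ) : Prop :=
  ∀ u v x y : List A, Legal θ u → Legal θ v → x ∈ reals θ u → y ∈ reals θ v →
    ∀ i j : ℕ, i + 2 * r < x.length → j + 2 * r < y.length →
      (∀ t ≤ 2 * r, x[i + t]? = y[j + t]?) →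
        (i + r) % ℓ = (j + r) % ℓ ∧ u[(i + r) / ℓ]? = v[(j + r) / ℓ]?

/-- Long stretches of level-`s` inflation words determine the level-`s` cuts. -/
lemma LocallyRecognisable.modEq (hr : LocallyRecognisable θ ℓ r) (hθ : ∀ a, (θ a).Nonempty)
    (hcl : ConstantLength θ ℓ) (s : ℕ) {u v x y : List A} (hu : Legal θ u) (hv : Legal θ v)
    (hx : x ∈ realsIter θ s u) (hy : y ∈ realsIter θ s v) {i j n : ℕ}
    (hn : ℓ ^ s * (2 * r + 1) ≤ n + 2 * r) (hi : i + n ≤ x.length) (hj : j + n ≤ y.length)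
    (hxy : ∀ t < n, x[i + t]? = y[j + t]?) : i ≡ j [MOD ℓ ^ s] := by
  induction s generalizing x y i j n with
  | zero => simpa using Nat.modEq_one
  | succ s ih =>
    obtain ⟨x', hx', hx⟩ := mem_realsIter_succ_right.1 hx
    obtain ⟨y', hy', hy⟩ := mem_realsIter_succ_right.1 hy
    have hℓ := hcl.1
    have hx'l := hu.of_mem_realsIter hθ hx'
    have hy'l := hv.of_mem_realsIter hθ hy'
    obtain ⟨n', hn'⟩ : ∃ n', n' + 2 * r = ℓ ^ s * (2 * r + 1) :=
      ⟨ℓ ^ s * (2 * r + 1) - 2 * r, Nat.sub_add_cancel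
        (by nlinarith [Nat.one_le_pow s ℓ (by omega)])⟩
    have hn'pos : 0 < n' := by nlinarith [Nat.one_le_pow s ℓ (by omega)]
    have hstretch : ℓ * n' + 2 * r ≤ n := by
      have h1 : ℓ * (n' + 2 * r) ≤ n + 2 * r := by
        rw [hn', ← mul_assoc, ← pow_succ']
        exact hn
      nlinarith
    have key (t : ℕ) (ht : ℓ * t + 2 * r < n) :=
      hr x' y' x y hx'l hy'l hx hy (i + ℓ * t) (j + ℓ * t) (by omega) (by omega)
        fun t' ht' => by
          simpa [Nat.add_assoc] using hxy (ℓ * t + t') (by omega)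
    have hmod : (i + r) % ℓ = (j + r) % ℓ := by
      simpa using (key 0 (by nlinarith)).1
    have hlx := hcl.length_reals hx
    have hly := hcl.length_reals hy
    have hdi := Nat.div_add_mod (i + r) ℓ
    have hdj := Nat.div_add_mod (j + r) ℓ
    have bound {c : ℕ} {z z' : List A} (hz : z.length = ℓ * z'.length)
        (hc : c + n ≤ z.length) : (c + r) / ℓ + n' ≤ z'.length := by
      refine Nat.le_of_mul_le_mul_left (?_ : ℓ * _ ≤ ℓ * _) (by omega)
      have := Nat.mul_div_le (c + r) ℓ
      rw [Nat.mul_add]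
      omega
    have hrec := ih hx' hy' (i := (i + r) / ℓ) (j := (j + r) / ℓ) hn'.ge (bound hlx hi)
      (bound hly hj) fun t ht => by
        have h1 : ℓ * t + ℓ ≤ ℓ * n' := by
          rw [← Nat.mul_succ]
          exact Nat.mul_le_mul_left _ ht
        have h2 := (key t (by omega)).2
        rw [show i + ℓ * t + r = i + r + ℓ * t by ring,
          show j + ℓ * t + r = j + r + ℓ * t by ring,
          Nat.add_mul_div_left _ _ (by omega), Nat.add_mul_div_left _ _ (by omega)] at h2
        exact h2
    have h3 := (hrec.mul_left' ℓ).add_right ((i + r) % ℓ)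
    rw [← pow_succ', hdi, hmod, hdj] at h3
    exact Nat.ModEq.add_right_cancel' r h3

lemma vecMul_one_substM (h : IsRandomSubstitution θ P) (hcl : ConstantLength θ ℓ) (c : ℝ) :
    Matrix.vecMul (fun _ => c) (substM θ P) = fun _ => ℓ * c := by
  ext a
  rw [vecMul_substM]
  calc ∑ w ∈ θ a, P a w * letterSum (fun _ => c) w = ∑ w ∈ θ a, P a w * (ℓ * c) :=
        Finset.sum_congr rfl fun w hw => by rw [letterSum_const, hcl.2 a w hw]
    _ = ℓ * c := by rw [← Finset.sum_mul, h.2.2.2.2 a, one_mul]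

lemma vecMul_one_substM_pow (h : IsRandomSubstitution θ P) (hcl : ConstantLength θ ℓ)
    (n : ℕ) (c : ℝ) :
    Matrix.vecMul (fun _ => c) (substM θ P ^ n) = fun _ => (ℓ : ℝ) ^ n * c := by
  induction n generalizing c with
  | zero => simp
  | succ n ih =>
    rw [pow_succ', ← Matrix.vecMul_vecMul, vecMul_one_substM h hcl, ih]
    ext
    ring

lemma substM_nonneg (h : IsRandomSubstitution θ P) (a b : A) : 0 ≤ substM θ P a b :=
  Finset.sum_nonneg fun _ hw => mul_nonneg (h.nonneg hw) (Nat.cast_nonneg _)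

lemma substM_pow_nonneg (h : IsRandomSubstitution θ P) (n : ℕ) (a b : A) :
    0 ≤ (substM θ P ^ n) a b := by
  induction n generalizing a b with
  | zero => rw [pow_zero, Matrix.one_apply]; split_ifs <;> simp
  | succ n ih =>
    rw [pow_succ, Matrix.mul_apply]
    exact Finset.sum_nonneg fun c _ => mul_nonneg (ih a c) (substM_nonneg h c b)

lemma sum_substM_pow (h : IsRandomSubstitution θ P) (hcl : ConstantLength θ ℓ) (n : ℕ) (b : A) :
    ∑ a, (substM θ P ^ n) a b = (ℓ : ℝ) ^ n := by
  simpa [Matrix.vecMul, dotProduct] using congrFun (vecMul_one_substM_pow h hcl n 1) b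

/-- Entries of large powers of the substitution matrix grow at the rate `ℓ ^ n`. -/
lemma exists_le_substM_pow (h : IsRandomSubstitution θ P) (hcl : ConstantLength θ ℓ)
    (hprim : IsPrimitive θ P) :
    ∃ δ : ℝ, 0 < δ ∧ ∃ k : ℕ, ∀ n ≥ k, ∀ a b, δ * (ℓ : ℝ) ^ n ≤ (substM θ P ^ n) a b := by
  obtain ⟨k, hk⟩ := hprim
  have hℓ : (0 : ℝ) < ℓ := by exact_mod_cast (by have := hcl.1; omega : 0 < ℓ)
  obtain ⟨δ, hδ, hδk⟩ : ∃ δ : ℝ, 0 < δ ∧ ∀ a b, δ ≤ (substM θ P ^ k) a b := by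
    cases isEmpty_or_nonempty A
    · exact ⟨1, one_pos, fun a => isEmptyElim a⟩
    · obtain ⟨p, hp⟩ := Finite.exists_min fun p : A × A => (substM θ P ^ k) p.1 p.2
      exact ⟨_, hk p.1 p.2, fun a b => hp (a, b)⟩
  refine ⟨δ / (ℓ : ℝ) ^ k, by positivity, k, fun n hn a b => ?_⟩
  obtain ⟨m, rfl⟩ := Nat.exists_eq_add_of_le hn
  rw [pow_add (substM θ P), Matrix.mul_apply]
  calc δ / (ℓ : ℝ) ^ k * (ℓ : ℝ) ^ (k + m) = ∑ c, δ * (substM θ P ^ m) c b := by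
        rw [← Finset.mul_sum, sum_substM_pow h hcl, pow_add]
        field_simp
    _ ≤ _ := Finset.sum_le_sum fun c _ =>
        mul_le_mul_of_nonneg_right (hδk a c) (substM_pow_nonneg h m c b)

lemma letterSum_single (a : A) (u : List A) :
    letterSum (Pi.single a 1) u = (u.count a : ℝ) := by
  simp [letterSum_eq_sum_count, Pi.single_apply]

lemma markov_iterate_count (h : IsRandomSubstitution θ P) (n : ℕ) (a b : A) :
    (markov θ P)^[n] (fun u => (u.count a : ℝ)) [b] = (substM θ P ^ n) a b := by
  have := congrFun (markov_iterate_letterSum h n (Pi.single a 1)) [b]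
  rw [letterSum_singleton, Matrix.single_one_vecMul] at this
  simpa [← letterSum_single] using this

lemma exists_mem_realsIter_of_pos (h : IsRandomSubstitution θ P) {n : ℕ} {a b : A}
    (hpos : 0 < (substM θ P ^ n) a b) : ∃ x ∈ realsIter θ n [b], a ∈ x := by
  by_contra! hcon
  rw [← markov_iterate_count h, markov_iterate_congr h (G := fun _ => 0),
    markov_iterate_const h] at hpos
  · exact lt_irrefl _ hpos
  · intro x hx
    simpa using List.count_eq_zero_of_not_mem (hcon x hx)

/-- Every letter extends to arbitrarily long legal words on both sides. -/
lemma exists_legal_extension (h : IsRandomSubstitution θ P) (hcl : ConstantLength θ ℓ)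
    (hprim : IsPrimitive θ P) (a : A) (n : ℕ) :
    ∃ p q : List A, n ≤ p.length ∧ n ≤ q.length ∧ Legal θ (p ++ [a] ++ q) := by
  obtain ⟨δ, hδ, k, hk⟩ := exists_le_substM_pow h hcl hprim
  have hℓ := hcl.1
  obtain ⟨z, hz⟩ := realsIter_nonempty h.1 2 [a]
  have hzl := hcl.length_realsIter hz
  have hlen : 4 ≤ z.length := by
    rw [hzl]
    simp only [List.length_singleton]
    nlinarith
  obtain ⟨b, c, t, ht, rfl⟩ : ∃ b c, ∃ t : List A, t ≠ [] ∧ z = [b] ++ [c] ++ t := by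
    match z, hlen with
    | b :: c :: d :: t, _ => exact ⟨b, c, d :: t, by simp, by simp⟩
  have hpos : 0 < (substM θ P ^ (k + n)) a c := by
    have : (0 : ℝ) < ℓ := by exact_mod_cast (by omega : 0 < ℓ)
    exact (by positivity : 0 < δ * (ℓ : ℝ) ^ (k + n)).trans_le (hk _ (by omega) a c)
  obtain ⟨x, hx, hax⟩ := exists_mem_realsIter_of_pos h hpos
  obtain ⟨x₁, x₂, rfl⟩ := List.append_of_mem hax
  obtain ⟨p, hp⟩ := realsIter_nonempty h.1 (k + n) [b]
  obtain ⟨q, hq⟩ := realsIter_nonempty h.1 (k + n) t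
  have hgrow : n ≤ ℓ ^ (k + n) :=
    (by omega : n ≤ k + n).trans (Nat.lt_pow_self (by omega)).le
  refine ⟨p ++ x₁, x₂ ++ q, ?_, ?_, ?_⟩
  · rw [List.length_append, hcl.length_realsIter hp]
    simp only [List.length_singleton]
    omega
  · rw [List.length_append, hcl.length_realsIter hq]
    have : 1 ≤ t.length := List.length_pos_iff.2 ht
    nlinarith
  · have hmem : p ++ (x₁ ++ a :: x₂) ++ q ∈ realsIter θ (k + n) ([b] ++ [c] ++ t) :=
      mem_realsIter_append.2 ⟨_, mem_realsIter_append.2 ⟨p, hp, _, hx, rfl⟩, q, hq, rfl⟩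
    simpa using (legal_of_mem_realsIter hz).of_mem_realsIter h.1 hmem

/-- The level-`m` ancestor of a level-`(m + 1)` inflation word of a letter is unique. -/
lemma LocallyRecognisable.ancestor_unique (hr : LocallyRecognisable θ ℓ r)
    (h : IsRandomSubstitution θ P) (hcl : ConstantLength θ ℓ) (hprim : IsPrimitive θ P)
    {a : A} {m : ℕ} {x y w : List A} (hx : x ∈ realsIter θ m [a]) (hy : y ∈ realsIter θ m [a])
    (hwx : w ∈ reals θ x) (hwy : w ∈ reals θ y) : x = y := by
  obtain ⟨p, q, hp, hq, hpq⟩ := exists_legal_extension h hcl hprim a (r + 1)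
  obtain ⟨p', hp'⟩ := realsIter_nonempty h.1 m p
  obtain ⟨q', hq'⟩ := realsIter_nonempty h.1 m q
  obtain ⟨p'', hp''⟩ := reals_nonempty h.1 p'
  obtain ⟨q'', hq''⟩ := reals_nonempty h.1 q'
  have hℓ := hcl.1
  have hlegal {z : List A} (hz : z ∈ realsIter θ m [a]) : Legal θ (p' ++ z ++ q') :=
    hpq.of_mem_realsIter h.1
      (mem_realsIter_append.2 ⟨_, mem_realsIter_append.2 ⟨p', hp', z, hz, rfl⟩, q', hq', rfl⟩)
  have hmem {z : List A} (hz : w ∈ reals θ z) : p'' ++ w ++ q'' ∈ reals θ (p' ++ z ++ q') :=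
    mem_reals_append.2 ⟨_, mem_reals_append.2 ⟨p'', hp'', w, hz, rfl⟩, q'', hq'', rfl⟩
  have hone : 1 ≤ ℓ ^ m := Nat.one_le_pow _ _ (by omega)
  have hp'l : r + 1 ≤ p'.length := by rw [hcl.length_realsIter hp']; nlinarith
  have hq'l : r + 1 ≤ q'.length := by rw [hcl.length_realsIter hq']; nlinarith
  have hq''l : r + 1 ≤ q''.length := by rw [hcl.length_reals hq'']; nlinarith
  have hwl := hcl.length_reals hwx
  have hlxy : x.length = y.length := by
    rw [hcl.length_realsIter hx, hcl.length_realsIter hy]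
  refine List.ext_getElem hlxy fun j hj hj' => ?_
  obtain ⟨i, hi⟩ : ∃ i, i + r = ℓ * (p'.length + j) :=
    ⟨ℓ * (p'.length + j) - r, Nat.sub_add_cancel (by nlinarith)⟩
  have hfit : i + 2 * r < (p'' ++ w ++ q'').length := by
    simp only [List.length_append, hcl.length_reals hp'', hwl]
    nlinarith
  have hkey := (hr _ _ _ _ (hlegal hx) (hlegal hy) (hmem hwx) (hmem hwy) i i hfit hfit
    fun _ _ => rfl).2
  have hget {z : List A} (hz : j < z.length) :
      (p' ++ z ++ q')[p'.length + j]? = some z[j] := by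
    rw [List.append_assoc, List.getElem?_append_right (by omega), Nat.add_sub_cancel_left,
      List.getElem?_append_left hz, List.getElem?_eq_getElem hz]
  rw [hi, Nat.mul_div_cancel_left _ (by omega), hget hj, hget hj'] at hkey
  exact Option.some.inj hkey

end Supertiles

section Harmonic

variable {θ : A → Finset (List A)} {P : A → List A → ℝ} {ℓ : ℕ}

lemma Matrix.exists_pow_mul_pow_eq_zero (M : Matrix A A ℝ) (l : ℝ)
    (hM : ∀ z ∈ spectrum ℂ (M.map Complex.ofReal), z = 0 ∨ z = (l : ℂ)) :
    ∃ d : ℕ, M ^ d * (M - l • 1) ^ d = 0 := by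
  set N : Matrix A A ℂ := M.map Complex.ofReal with hN
  let q : Polynomial ℂ := Polynomial.X * (Polynomial.X - Polynomial.C (l : ℂ))
  have hroots (s : Multiset ℂ) (hs : ∀ z ∈ s, z = 0 ∨ z = (l : ℂ)) :
      (s.map fun z => Polynomial.X - Polynomial.C z).prod ∣ q ^ Multiset.card s := by
    induction s using Multiset.induction_on with
    | empty => simp
    | cons z s ih =>
      rw [Multiset.map_cons, Multiset.prod_cons, Multiset.card_cons, pow_succ']
      refine mul_dvd_mul ?_ (ih fun y hy => hs y (Multiset.mem_cons_of_mem hy))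
      rcases hs z (Multiset.mem_cons_self z s) with rfl | rfl
      · simp [q]
      · exact dvd_mul_left _ _
  have hsplit := (IsAlgClosed.splits N.charpoly).eq_prod_roots_of_monic N.charpoly_monic
  have hdvd : N.charpoly ∣ q ^ Multiset.card N.charpoly.roots := by
    rw [hsplit]
    conv_rhs => rw [← hsplit]
    refine hroots _ fun z hz => hM z ?_
    exact Matrix.mem_spectrum_iff_isRoot_charpoly.2 (Polynomial.isRoot_of_mem_roots hz)
  refine ⟨Multiset.card N.charpoly.roots, ?_⟩
  have h0 : Polynomial.aeval N (q ^ Multiset.card N.charpoly.roots) = 0 := by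
    obtain ⟨p, hp⟩ := hdvd
    rw [hp, map_mul, Matrix.aeval_self_charpoly, zero_mul]
  have hcomm : Commute N (N - (l : ℂ) • 1) :=
    (Commute.refl N).sub_right ((Commute.one_right N).smul_right _)
  have h1 : N ^ Multiset.card N.charpoly.roots *
      (N - (l : ℂ) • 1) ^ Multiset.card N.charpoly.roots = 0 := by
    rw [← hcomm.mul_pow, ← h0]
    simp [q, Algebra.algebraMap_eq_smul_one]
  let φ : Matrix A A ℝ →+* Matrix A A ℂ := Complex.ofRealHom.mapMatrix
  have hφ : Function.Injective φ := Matrix.map_injective Complex.ofReal_injective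
  apply hφ
  have hφM : φ M = N := rfl
  have hφl : φ (l • 1) = (l : ℂ) • 1 := by
    ext i j
    by_cases hij : i = j <;> simp [φ, hij]
  rw [map_mul, map_pow, map_pow, map_sub, hφM, hφl, h1, map_zero]

lemma eq_zero_of_vecMul_substM (h : IsRandomSubstitution θ P) (hcl : ConstantLength θ ℓ)
    [Nonempty A] {f : A → ℝ} {c : ℝ}
    (hf : ∀ a, Matrix.vecMul f (substM θ P) a = ℓ * f a + c) : c = 0 := by
  have hle {g : A → ℝ} {b : ℝ} (hg : ∀ a, g a ≤ b) (a : A) :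
      Matrix.vecMul g (substM θ P) a ≤ ℓ * b := by
    rw [← congrFun (vecMul_one_substM h hcl b) a]
    exact Finset.sum_le_sum fun i _ => mul_le_mul_of_nonneg_right (hg i) (substM_nonneg h i a)
  obtain ⟨a, ha⟩ := Finite.exists_max f
  obtain ⟨b, hb⟩ := Finite.exists_min f
  have h1 := hle ha a
  have h2 := hle (g := -f) (b := -f b) (fun i => neg_le_neg (hb i)) b
  rw [Matrix.neg_vecMul, Pi.neg_apply, hf] at h2
  rw [hf] at h1
  linarith

lemma eq_const_of_vecMul_substM (h : IsRandomSubstitution θ P) (hcl : ConstantLength θ ℓ)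
    (hprim : IsPrimitive θ P) [Nonempty A] {f : A → ℝ}
    (hf : Matrix.vecMul f (substM θ P) = (ℓ : ℝ) • f) : ∃ c, ∀ a, f a = c := by
  obtain ⟨k, hk⟩ := hprim
  have hpow (n : ℕ) : Matrix.vecMul f (substM θ P ^ n) = (ℓ : ℝ) ^ n • f := by
    induction n with
    | zero => simp
    | succ n ih =>
      rw [pow_succ, ← Matrix.vecMul_vecMul, ih, Matrix.smul_vecMul, hf, smul_smul, pow_succ]
  obtain ⟨a, ha⟩ := Finite.exists_max f
  have hsum : ∑ i, (f a - f i) * (substM θ P ^ k) i a = 0 := by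
    have h1 := congrFun (hpow k) a
    simp only [Matrix.vecMul, dotProduct, Pi.smul_apply, smul_eq_mul] at h1
    simp only [sub_mul, Finset.sum_sub_distrib, ← Finset.mul_sum, sum_substM_pow h hcl, h1]
    ring
  refine ⟨f a, fun i => ?_⟩
  have h2 := (Finset.sum_eq_zero_iff_of_nonneg fun j _ =>
    mul_nonneg (sub_nonneg.2 (ha j)) (hk j a).le).1 hsum i (Finset.mem_univ i)
  have h3 := (mul_eq_zero.1 h2).resolve_right (hk i a).ne'
  linarith

lemma eq_const_of_vecMul_pow_eq_zero (h : IsRandomSubstitution θ P)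
    (hcl : ConstantLength θ ℓ) (hprim : IsPrimitive θ P) [Nonempty A] {f : A → ℝ} {n : ℕ}
    (hf : Matrix.vecMul f ((substM θ P - (ℓ : ℝ) • 1) ^ n) = 0) : ∃ c, ∀ a, f a = c := by
  induction n generalizing f with
  | zero => exact ⟨0, fun a => by simpa using congrFun hf a⟩
  | succ n ih =>
    rw [pow_succ', ← Matrix.vecMul_vecMul] at hf
    obtain ⟨c, hc⟩ := ih hf
    have hc' (a : A) : Matrix.vecMul f (substM θ P) a = ℓ * f a + c := by
      rw [← hc a, Matrix.vecMul_sub, Matrix.vecMul_smul, Matrix.vecMul_one]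
      simp
    have := eq_zero_of_vecMul_substM h hcl hc'
    exact eq_const_of_vecMul_substM h hcl hprim (funext fun a => by simp [hc' a, this])

/-- The logarithm of the number of realisations of a letter. -/
noncomputable def logCard (θ : A → Finset (List A)) (a : A) : ℝ := Real.log ((θ a).card)

lemma Compatible.letterSum_reals (hcomp : Compatible θ) (h : IsRandomSubstitution θ P)
    (f : A → ℝ) {u x : List A} (hx : x ∈ reals θ u) :
    letterSum f x = letterSum (Matrix.vecMul f (substM θ P)) u := by
  induction u generalizing x with
  | nil => simp_all [reals, letterSum_nil]
  | cons a u ih =>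
    obtain ⟨y, hy, z, hz, rfl⟩ := mem_reals_cons.1 hx
    rw [letterSum_append, letterSum_cons, ih hz, vecMul_substM]
    congr 1
    calc letterSum f y = ∑ w ∈ θ a, P a w * letterSum f y := by
          rw [← Finset.sum_mul, h.2.2.2.2 a, one_mul]
      _ = _ := Finset.sum_congr rfl fun w hw => by
          simp only [letterSum_eq_sum_count, hcomp a y hy w hw]

lemma Compatible.letterSum_realsIter (hcomp : Compatible θ) (h : IsRandomSubstitution θ P)
    (f : A → ℝ) {n : ℕ} {u x : List A} (hx : x ∈ realsIter θ n u) :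
    letterSum f x = letterSum (Matrix.vecMul f (substM θ P ^ n)) u := by
  induction n generalizing u with
  | zero => simp_all [realsIter]
  | succ n ih =>
    obtain ⟨v, hv, hx⟩ := mem_realsIter_succ.1 hx
    rw [ih hx, hcomp.letterSum_reals h _ hv, Matrix.vecMul_vecMul, pow_succ]

lemma exists_letterSum_logCard_eq [Nonempty A] (h : IsRandomSubstitution θ P)
    (hcl : ConstantLength θ ℓ) (hprim : IsPrimitive θ P)
    (hcase : (∀ a b : A, (θ a).card = (θ b).card) ∨
      (Compatible θ ∧
        ∀ z ∈ spectrum ℂ ((substM θ P).map Complex.ofReal), z = 0 ∨ z = (ℓ : ℂ))) :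
    ∃ (N : ℕ) (ρ : ℝ), ∀ (b : A), ∀ x ∈ realsIter θ N [b], letterSum (logCard θ) x = ρ := by
  rcases hcase with hcard | ⟨hcomp, hspec⟩
  · obtain ⟨a⟩ := ‹Nonempty A›
    refine ⟨0, logCard θ a, fun b x hx => ?_⟩
    obtain rfl : x = [b] := by simpa [realsIter] using hx
    rw [letterSum_singleton, logCard, logCard, hcard b a]
  · obtain ⟨d, hd⟩ := Matrix.exists_pow_mul_pow_eq_zero (substM θ P) ℓ
      (by exact_mod_cast hspec)
    obtain ⟨c, hc⟩ := eq_const_of_vecMul_pow_eq_zero h hcl hprim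
      (f := Matrix.vecMul (logCard θ) (substM θ P ^ d)) (n := d)
      (by rw [Matrix.vecMul_vecMul, hd, Matrix.vecMul_zero])
    refine ⟨d, c, fun b x hx => ?_⟩
    rw [hcomp.letterSum_realsIter h _ hx, letterSum_singleton, hc]

lemma letterSum_realsIter_eq {N : ℕ} {ρ : ℝ} {f : A → ℝ}
    (hN : ∀ (b : A), ∀ x ∈ realsIter θ N [b], letterSum f x = ρ) {u x : List A}
    (hx : x ∈ realsIter θ N u) : letterSum f x = u.length * ρ := by
  induction u generalizing x with
  | nil => simp [eq_nil_of_mem_realsIter_nil hx, letterSum]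
  | cons a u ih =>
    rw [← List.singleton_append] at hx
    obtain ⟨y, hy, z, hz, rfl⟩ := mem_realsIter_append.1 hx
    rw [letterSum_append, hN a y hy, ih hz, List.length_cons]
    push_cast
    ring

end Harmonic

section Gibbs

variable {θ : A → Finset (List A)} {P : A → List A → ℝ} {ℓ r : ℕ}

lemma wordProb_eq_exp (h : IsRandomSubstitution θ P) (hcl : ConstantLength θ ℓ)
    (hunif : ∀ a : A, ∀ s ∈ θ a, P a s = ((θ a).card : ℝ)⁻¹) {u w : List A}
    (hw : w ∈ reals θ u) : wordProb θ P u w = Real.exp (-letterSum (logCard θ) u) := by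
  induction u generalizing w with
  | nil => simp_all [wordProb, reals, letterSum_nil]
  | cons a u ih =>
    obtain ⟨y, hy, z, hz, rfl⟩ := mem_reals_cons.1 hw
    have hcard : (0 : ℝ) < (θ a).card := by exact_mod_cast Finset.card_pos.2 (h.1 a)
    rw [wordProb, Finset.sum_eq_single y, if_pos (List.prefix_append y z), List.drop_left,
      ih hz, hunif a y hy, letterSum_cons, neg_add, Real.exp_add, logCard,
      Real.exp_neg (Real.log _), Real.exp_log hcard]
    · intro v hv hvy
      rw [if_neg, mul_zero]
      intro hpre
      have hlen : v.length = y.length := by rw [hcl.2 a v hv, hcl.2 a y hy]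
      exact hvy ((List.prefix_of_prefix_length_le hpre (List.prefix_append y z)
        hlen.le).eq_of_length hlen)
    · exact fun hn => absurd hy hn

lemma markov_iterate_indicator (n : ℕ) (u w : List A) :
    (markov θ P)^[n] (fun x => if x = w then 1 else 0) u = iterProb θ P n u w := by
  rw [← sum_iterProb_mul]
  by_cases hw : w ∈ realsIter θ n u
  · simp [hw]
  · simp [hw, iterProb_eq_zero hw]

lemma markov_indicator (u w : List A) :
    markov θ P (fun x => if x = w then 1 else 0) u = wordProb θ P u w := by
  by_cases hw : w ∈ reals θ u
  · simp [markov, hw]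
  · simp [markov, hw, wordProb_eq_zero hw]

lemma iterProb_succ_right (n : ℕ) (u w : List A) :
    iterProb θ P (n + 1) u w =
      ∑ x ∈ realsIter θ n u, iterProb θ P n u x * wordProb θ P x w := by
  rw [← markov_iterate_indicator, Function.iterate_succ_apply, ← sum_iterProb_mul]
  simp only [markov_indicator]

lemma sum_iterProb (h : IsRandomSubstitution θ P) (n : ℕ) (u : List A) :
    ∑ w ∈ realsIter θ n u, iterProb θ P n u w = 1 := by
  simpa [markov_iterate_const h] using sum_iterProb_mul (θ := θ) (P := P) n (fun _ => 1) u

lemma LocallyRecognisable.iterProb_succ (hr : LocallyRecognisable θ ℓ r)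
    (h : IsRandomSubstitution θ P) (hcl : ConstantLength θ ℓ) (hprim : IsPrimitive θ P)
    (hunif : ∀ a : A, ∀ s ∈ θ a, P a s = ((θ a).card : ℝ)⁻¹) {m : ℕ} {b : A} {x w : List A}
    (hx : x ∈ realsIter θ m [b]) (hw : w ∈ reals θ x) :
    iterProb θ P (m + 1) [b] w =
      iterProb θ P m [b] x * Real.exp (-letterSum (logCard θ) x) := by
  rw [iterProb_succ_right, Finset.sum_eq_single x, wordProb_eq_exp h hcl hunif hw]
  · intro y hy hyx
    rw [wordProb_eq_zero fun hwy => hyx (hr.ancestor_unique h hcl hprim hy hx hwy hw), mul_zero]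
  · exact fun hn => absurd hx hn

lemma LocallyRecognisable.iterProb_pos (hr : LocallyRecognisable θ ℓ r)
    (h : IsRandomSubstitution θ P) (hcl : ConstantLength θ ℓ) (hprim : IsPrimitive θ P)
    (hunif : ∀ a : A, ∀ s ∈ θ a, P a s = ((θ a).card : ℝ)⁻¹) {m : ℕ} {b : A} {w : List A}
    (hw : w ∈ realsIter θ m [b]) : 0 < iterProb θ P m [b] w := by
  induction m generalizing w with
  | zero =>
    obtain rfl : w = [b] := by simpa [realsIter] using hw
    simp [iterProb]
  | succ m ih =>
    obtain ⟨x, hx, hw⟩ := mem_realsIter_succ_right.1 hw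
    rw [hr.iterProb_succ h hcl hprim hunif hx hw]
    exact mul_pos (ih hx) (Real.exp_pos _)

lemma logCard_nonneg (a : A) : 0 ≤ logCard θ a := Real.log_natCast_nonneg _

lemma LocallyRecognisable.exists_abs_log_iterProb_le [Nonempty A]
    (hr : LocallyRecognisable θ ℓ r)
    (h : IsRandomSubstitution θ P) (hcl : ConstantLength θ ℓ) (hprim : IsPrimitive θ P)
    (hcase : (∀ a b : A, (θ a).card = (θ b).card) ∨
      (Compatible θ ∧
        ∀ z ∈ spectrum ℂ ((substM θ P).map Complex.ofReal), z = 0 ∨ z = (ℓ : ℂ)))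
    (hunif : ∀ a : A, ∀ s ∈ θ a, P a s = ((θ a).card : ℝ)⁻¹) :
    ∃ η C : ℝ, 0 ≤ η ∧ ∀ (m : ℕ) (b : A), ∀ w ∈ realsIter θ m [b],
      |Real.log (iterProb θ P m [b] w) + (ℓ : ℝ) ^ m * η| ≤ C := by
  obtain ⟨N, ρ, hN⟩ := exists_letterSum_logCard_eq h hcl hprim hcase
  have hℓ : (1 : ℝ) < ℓ := by exact_mod_cast hcl.1
  have hℓ1 : (0 : ℝ) < ℓ - 1 := sub_pos.2 hℓ
  have hρ : 0 ≤ ρ := by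
    obtain ⟨b⟩ := ‹Nonempty A›
    obtain ⟨x, hx⟩ := realsIter_nonempty h.1 N [b]
    rw [← hN b x hx]
    refine List.sum_nonneg fun t ht => ?_
    obtain ⟨a, -, rfl⟩ := List.mem_map.1 ht
    exact logCard_nonneg a
  set η : ℝ := ρ / ((ℓ : ℝ) ^ N * (ℓ - 1)) with hη
  let D (m : ℕ) (b : A) (w : List A) : ℝ :=
    Real.log (iterProb θ P m [b] w) + (ℓ : ℝ) ^ m * η
  obtain ⟨C, hC⟩ := Finset.exists_le ((Finset.range (N + 1)).biUnion fun n =>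
    Finset.univ.biUnion fun b => (realsIter θ n [b]).image fun w => |D n b w|)
  have hsmall (n : ℕ) (hn : n ≤ N) (b : A) (w : List A) (hw : w ∈ realsIter θ n [b]) :
      |D n b w| ≤ C := by
    refine hC _ (Finset.mem_biUnion.2 ⟨n, Finset.mem_range.2 (by omega), ?_⟩)
    exact Finset.mem_biUnion.2 ⟨b, Finset.mem_univ b, Finset.mem_image_of_mem _ hw⟩
  refine ⟨η, C, by positivity, fun m => ?_⟩
  rcases le_total m N with hm | hm
  · exact fun b w hw => hsmall m hm b w hw
  · induction m, hm using Nat.le_induction with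
    | base => exact fun b w hw => hsmall N le_rfl b w hw
    | succ m hm ih =>
      intro b w hw
      obtain ⟨x, hx, hwx⟩ := mem_realsIter_succ_right.1 hw
      convert ih b x hx using 2
      have hsum : letterSum (logCard θ) x = (ℓ : ℝ) ^ (m - N) * ρ := by
        have hx' := hx
        rw [← Nat.sub_add_cancel hm] at hx'
        obtain ⟨v, hv, hxv⟩ := mem_realsIter_add.1 hx'
        rw [letterSum_realsIter_eq hN hxv, hcl.length_realsIter hv]
        simp
      rw [hr.iterProb_succ h hcl hprim hunif hx hwx,
        Real.log_mul (hr.iterProb_pos h hcl hprim hunif hx).ne' (Real.exp_pos _).ne',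
        Real.log_exp, hsum]
      have hpow : (ℓ : ℝ) ^ m = (ℓ : ℝ) ^ (m - N) * (ℓ : ℝ) ^ N := by
        rw [← pow_add, Nat.sub_add_cancel hm]
      have hηρ : (ℓ : ℝ) ^ N * ((ℓ - 1) * η) = ρ := by
        rw [hη]
        field_simp
      rw [pow_succ, hpow]
      linear_combination ((ℓ : ℝ) ^ (m - N)) * hηρ

/-- Two-sided bounds, uniform up to a multiplicative constant, for the probabilities of the
level-`m` inflation words. -/
def ProbBounds (θ : A → Finset (List A)) (P : A → List A → ℝ) (ℓ : ℕ) (η C : ℝ) : Prop :=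
  ∀ (m : ℕ) (b : A), ∀ w ∈ realsIter θ m [b],
    Real.exp (-C - (ℓ : ℝ) ^ m * η) ≤ iterProb θ P m [b] w ∧
      iterProb θ P m [b] w ≤ Real.exp (C - (ℓ : ℝ) ^ m * η)

lemma LocallyRecognisable.exists_probBounds [Nonempty A] (hr : LocallyRecognisable θ ℓ r)
    (h : IsRandomSubstitution θ P) (hcl : ConstantLength θ ℓ) (hprim : IsPrimitive θ P)
    (hcase : (∀ a b : A, (θ a).card = (θ b).card) ∨
      (Compatible θ ∧
        ∀ z ∈ spectrum ℂ ((substM θ P).map Complex.ofReal), z = 0 ∨ z = (ℓ : ℂ)))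
    (hunif : ∀ a : A, ∀ s ∈ θ a, P a s = ((θ a).card : ℝ)⁻¹) :
    ∃ η C : ℝ, 0 ≤ η ∧ 0 ≤ C ∧ ProbBounds θ P ℓ η C := by
  obtain ⟨η, C, hη, hC⟩ := hr.exists_abs_log_iterProb_le h hcl hprim hcase hunif
  obtain ⟨b₀⟩ := ‹Nonempty A›
  refine ⟨η, C, hη, (abs_nonneg _).trans (hC 0 b₀ [b₀] (by simp [realsIter])),
    fun m b w hw => ?_⟩
  have hpos := hr.iterProb_pos h hcl hprim hunif hw
  have := abs_le.1 (hC m b w hw)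
  rw [← Real.le_log_iff_exp_le hpos, ← Real.log_le_iff_le_exp hpos]
  constructor <;> linarith

lemma ProbBounds.card_le {η C : ℝ} (hB : ProbBounds θ P ℓ η C) (h : IsRandomSubstitution θ P)
    (m : ℕ) (b : A) :
    ((realsIter θ m [b]).card : ℝ) ≤ Real.exp (C + (ℓ : ℝ) ^ m * η) := by
  have h1 := Finset.card_nsmul_le_sum (realsIter θ m [b]) (iterProb θ P m [b]) _
    fun w hw => (hB m b w hw).1
  rw [sum_iterProb h, nsmul_eq_mul] at h1
  calc ((realsIter θ m [b]).card : ℝ)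
      = (realsIter θ m [b]).card * Real.exp (-C - (ℓ : ℝ) ^ m * η) *
          Real.exp (C + (ℓ : ℝ) ^ m * η) := by
        rw [mul_assoc, ← Real.exp_add]
        simp
    _ ≤ 1 * Real.exp (C + (ℓ : ℝ) ^ m * η) := by gcongr
    _ = _ := one_mul _

lemma ProbBounds.le_card {η C : ℝ} (hB : ProbBounds θ P ℓ η C) (h : IsRandomSubstitution θ P)
    (m : ℕ) (b : A) :
    Real.exp ((ℓ : ℝ) ^ m * η - C) ≤ ((realsIter θ m [b]).card : ℝ) := by
  have h1 := Finset.sum_le_card_nsmul (realsIter θ m [b]) (iterProb θ P m [b]) _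
    fun w hw => (hB m b w hw).2
  rw [sum_iterProb h, nsmul_eq_mul] at h1
  calc Real.exp ((ℓ : ℝ) ^ m * η - C) = 1 * Real.exp ((ℓ : ℝ) ^ m * η - C) := (one_mul _).symm
    _ ≤ (realsIter θ m [b]).card * Real.exp (C - (ℓ : ℝ) ^ m * η) *
          Real.exp ((ℓ : ℝ) ^ m * η - C) := by gcongr
    _ = _ := by
        rw [mul_assoc, ← Real.exp_add]
        simp

end Gibbs

section Entropy

variable {θ : A → Finset (List A)} {P : A → List A → ℝ} {ℓ : ℕ}

lemma mem_allWords {n : ℕ} {w : List A} : w ∈ allWords A n ↔ w.length = n := by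
  simp only [allWords, Finset.mem_image, Finset.mem_univ, true_and]
  constructor
  · rintro ⟨f, rfl⟩
    simp
  · rintro rfl
    exact ⟨w.get, List.ofFn_get w⟩

lemma mem_legalWords {n : ℕ} {w : List A} :
    w ∈ legalWords θ n ↔ w.length = n ∧ Legal θ w := by
  simp [legalWords, mem_allWords]

lemma card_legalWords_le (θ : A → Finset (List A)) (n : ℕ) :
    (legalWords θ n).card ≤ Fintype.card A ^ n := by
  have hsub : legalWords θ n ⊆ allWords A n := fun w hw => mem_allWords.2 (mem_legalWords.1 hw).1
  refine (Finset.card_le_card hsub).trans (Finset.card_image_le.trans ?_)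
  simp

lemma log_card_legalWords_div_le [Nonempty A] (θ : A → Finset (List A)) (n : ℕ) :
    Real.log ((legalWords θ n).card) / (n : ℝ) ≤ Real.log (Fintype.card A) := by
  have hA : 0 ≤ Real.log (Fintype.card A) := Real.log_natCast_nonneg _
  rcases Nat.eq_zero_or_pos (legalWords θ n).card with h0 | h0
  · simpa [h0] using hA
  · refine div_le_of_le_mul₀ n.cast_nonneg hA ?_
    rw [mul_comm, ← Real.log_pow]
    exact Real.log_le_log (by exact_mod_cast h0) (by exact_mod_cast card_legalWords_le θ n)

lemma log_card_legalWords_div_nonneg (θ : A → Finset (List A)) (n : ℕ) :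
    0 ≤ Real.log ((legalWords θ n).card) / (n : ℝ) :=
  div_nonneg (Real.log_natCast_nonneg _) n.cast_nonneg

lemma isBoundedUnder_log_card_legalWords [Nonempty A] (θ : A → Finset (List A)) :
    IsBoundedUnder (· ≤ ·) atTop
      fun n : ℕ => Real.log ((legalWords θ n).card) / (n : ℝ) :=
  isBoundedUnder_of ⟨_, log_card_legalWords_div_le θ⟩

lemma isCoboundedUnder_log_card_legalWords (θ : A → Finset (List A)) :
    IsCoboundedUnder (· ≤ ·) atTop
      fun n : ℕ => Real.log ((legalWords θ n).card) / (n : ℝ) :=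
  (isBoundedUnder_of ⟨0, log_card_legalWords_div_nonneg θ⟩ :
    IsBoundedUnder (· ≥ ·) atTop _).isCoboundedUnder_le

/-- All level-`m` inflation words. -/
def blocks (θ : A → Finset (List A)) (m : ℕ) : Finset (List A) :=
  Finset.univ.biUnion fun b => realsIter θ m [b]

/-- Concatenations of `n` level-`m` inflation words. -/
def blockConcat (θ : A → Finset (List A)) (m : ℕ) : ℕ → Finset (List A)
  | 0 => {[]}
  | n + 1 => Finset.image₂ (fun x y => x ++ y) (blocks θ m) (blockConcat θ m n)

lemma card_blockConcat_le (θ : A → Finset (List A)) (m n : ℕ) :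
    (blockConcat θ m n).card ≤ (blocks θ m).card ^ n := by
  induction n with
  | zero => simp [blockConcat]
  | succ n ih =>
    rw [pow_succ']
    exact Finset.card_image₂_le _ _ _ |>.trans (Nat.mul_le_mul_left _ ih)

lemma blockConcat_nonempty [Nonempty A] (hθ : ∀ a, (θ a).Nonempty) (m n : ℕ) :
    (blockConcat θ m n).Nonempty := by
  induction n with
  | zero => simp [blockConcat]
  | succ n ih =>
    obtain ⟨b⟩ := ‹Nonempty A›
    obtain ⟨x, hx⟩ := realsIter_nonempty hθ m [b]
    exact Finset.Nonempty.image₂ ⟨x, Finset.mem_biUnion.2 ⟨b, Finset.mem_univ b, hx⟩⟩ ih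

lemma exists_mem_blockConcat [Nonempty A] (hθ : ∀ a, (θ a).Nonempty)
    (hcl : ConstantLength θ ℓ) {m : ℕ} (n : ℕ) {v x : List A} (hx : x ∈ realsIter θ m v) :
    ∃ y ∈ blockConcat θ m n, x.take (ℓ ^ m * n) <+: y := by
  induction n generalizing v x with
  | zero => exact ⟨[], by simp [blockConcat], by simp⟩
  | succ n ih =>
    cases v with
    | nil =>
      obtain ⟨y, hy⟩ := blockConcat_nonempty hθ m (n + 1)
      exact ⟨y, hy, by simp [eq_nil_of_mem_realsIter_nil hx]⟩
    | cons b v =>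
      rw [← List.singleton_append] at hx
      obtain ⟨x₁, hx₁, x₂, hx₂, rfl⟩ := mem_realsIter_append.1 hx
      obtain ⟨y, hy, hxy⟩ := ih hx₂
      have hlen : x₁.length = ℓ ^ m := by simpa using hcl.length_realsIter hx₁
      refine ⟨x₁ ++ y, Finset.mem_image₂_of_mem
        (Finset.mem_biUnion.2 ⟨b, Finset.mem_univ b, hx₁⟩) hy, ?_⟩
      rw [mul_add, mul_one, add_comm, ← hlen, List.take_length_add_append, hlen]
      exact (List.prefix_append_right_inj x₁).2 hxy

lemma ConstantLength.drop_mem_realsIter (hcl : ConstantLength θ ℓ) {m : ℕ} (q : ℕ)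
    {v x : List A} (hx : x ∈ realsIter θ m v) :
    x.drop (ℓ ^ m * q) ∈ realsIter θ m (v.drop q) := by
  induction q generalizing v x with
  | zero => simpa using hx
  | succ q ih =>
    cases v with
    | nil =>
      obtain rfl := eq_nil_of_mem_realsIter_nil hx
      simpa using hx
    | cons b v =>
      rw [← List.singleton_append] at hx
      obtain ⟨x₁, hx₁, x₂, hx₂, rfl⟩ := mem_realsIter_append.1 hx
      have hlen : x₁.length = ℓ ^ m := by simpa using hcl.length_realsIter hx₁
      rw [mul_add, mul_one, add_comm (ℓ ^ m * q), ← hlen, List.drop_length_add_append, hlen]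
      simpa using ih hx₂

lemma legalWords_subset [Nonempty A] (hθ : ∀ a, (θ a).Nonempty) (hcl : ConstantLength θ ℓ)
    {m n : ℕ} (hn : ℓ ^ m ≤ n) :
    legalWords θ n ⊆ Finset.image₂ (fun e y => (y.drop e).take n) (Finset.range (ℓ ^ m))
      (blockConcat θ m (n / ℓ ^ m + 2)) := by
  intro w hw
  obtain ⟨rfl, a, k, x, hx, hwx⟩ := mem_legalWords.1 hw
  have hℓ : 0 < ℓ ^ m := pow_pos (by have := hcl.1; omega) m
  have hmk : m ≤ k := by
    have h1 := hwx.length_le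
    rw [hcl.length_realsIter hx, List.length_singleton, mul_one] at h1
    exact (Nat.pow_le_pow_iff_right hcl.1).1 (hn.trans h1)
  rw [← Nat.sub_add_cancel hmk] at hx
  obtain ⟨v, -, hxv⟩ := mem_realsIter_add.1 hx
  obtain ⟨s, t, rfl⟩ := hwx
  set q := s.length / ℓ ^ m
  set e := s.length % ℓ ^ m
  have hqe : ℓ ^ m * q + e = s.length := Nat.div_add_mod _ _
  have he : e < ℓ ^ m := Nat.mod_lt _ hℓ
  obtain ⟨y, hy, hpre⟩ :=
    exists_mem_blockConcat hθ hcl (w.length / ℓ ^ m + 2) (hcl.drop_mem_realsIter q hxv)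
  refine Finset.mem_image₂.2 ⟨e, Finset.mem_range.2 he, y, hy, ?_⟩
  have hlen : e + w.length ≤ ℓ ^ m * (w.length / ℓ ^ m + 2) := by
    have h1 := Nat.div_add_mod w.length (ℓ ^ m)
    have h2 := Nat.mod_lt w.length hℓ
    rw [mul_add]
    omega
  have h2 : w <+: (((s ++ w ++ t).drop (ℓ ^ m * q)).take
      (ℓ ^ m * (w.length / ℓ ^ m + 2))).drop e := by
    rw [List.drop_take, List.drop_drop, hqe, List.append_assoc, List.drop_left,
      List.prefix_take_iff]
    exact ⟨List.prefix_append w t, by omega⟩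
  exact (List.prefix_iff_eq_take.1 (h2.trans (hpre.drop e))).symm

lemma ProbBounds.log_card_legalWords_le [Nonempty A] {η C : ℝ} (hB : ProbBounds θ P ℓ η C)
    (hη : 0 ≤ η) (hC : 0 ≤ C) (h : IsRandomSubstitution θ P) (hcl : ConstantLength θ ℓ)
    {m n : ℕ} (hn : ℓ ^ m ≤ n) :
    Real.log ((legalWords θ n).card) ≤ m * Real.log ℓ +
      ((n : ℝ) / (ℓ : ℝ) ^ m + 2) * (Real.log (Fintype.card A) + C + (ℓ : ℝ) ^ m * η) := by
  have hℓ : (0 : ℝ) < ℓ := by exact_mod_cast (by have := hcl.1; omega : 0 < ℓ)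
  have hA : (0 : ℝ) < Fintype.card A := by exact_mod_cast Fintype.card_pos
  have hlogA : 0 ≤ Real.log (Fintype.card A) := Real.log_natCast_nonneg _
  have hlogℓ : 0 ≤ Real.log ℓ := Real.log_natCast_nonneg _
  rcases Nat.eq_zero_or_pos (legalWords θ n).card with h0 | h0
  · rw [h0]
    simp only [Nat.cast_zero, Real.log_zero]
    positivity
  have hblocks : ((blocks θ m).card : ℝ) ≤
      Fintype.card A * Real.exp (C + (ℓ : ℝ) ^ m * η) := by
    calc ((blocks θ m).card : ℝ) ≤ ∑ b, ((realsIter θ m [b]).card : ℝ) := by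
          exact_mod_cast Finset.card_biUnion_le
      _ ≤ ∑ _b : A, Real.exp (C + (ℓ : ℝ) ^ m * η) :=
          Finset.sum_le_sum fun b _ => hB.card_le h m b
      _ = _ := by simp
  have hcard : ((legalWords θ n).card : ℝ) ≤
      (ℓ : ℝ) ^ m * (Fintype.card A * Real.exp (C + (ℓ : ℝ) ^ m * η)) ^ (n / ℓ ^ m + 2) := by
    calc ((legalWords θ n).card : ℝ) ≤ (ℓ : ℝ) ^ m * ((blocks θ m).card : ℝ) ^ (n / ℓ ^ m + 2) := by
          have := (Finset.card_le_card (legalWords_subset h.1 hcl hn)).trans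
            (Finset.card_image₂_le _ _ _)
          rw [Finset.card_range] at this
          exact_mod_cast this.trans (Nat.mul_le_mul_left _ (card_blockConcat_le θ m _))
      _ ≤ _ := by gcongr
  have hdiv : ((n / ℓ ^ m : ℕ) : ℝ) ≤ (n : ℝ) / (ℓ : ℝ) ^ m := by
    exact_mod_cast (Nat.cast_div_le : ((n / ℓ ^ m : ℕ) : ℝ) ≤ (n : ℝ) / (ℓ ^ m : ℕ))
  calc Real.log ((legalWords θ n).card)
      ≤ Real.log ((ℓ : ℝ) ^ m *
          (Fintype.card A * Real.exp (C + (ℓ : ℝ) ^ m * η)) ^ (n / ℓ ^ m + 2)) :=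
        Real.log_le_log (by exact_mod_cast h0) hcard
    _ = m * Real.log ℓ + ((n / ℓ ^ m : ℕ) + 2 : ℝ) *
          (Real.log (Fintype.card A) + C + (ℓ : ℝ) ^ m * η) := by
        rw [Real.log_mul (by positivity) (by positivity), Real.log_pow, Real.log_pow,
          Real.log_mul hA.ne' (Real.exp_pos _).ne', Real.log_exp]
        push_cast
        ring
    _ ≤ _ := by gcongr

lemma ProbBounds.topEntropy_le [Nonempty A] {η C : ℝ} (hB : ProbBounds θ P ℓ η C)
    (hη : 0 ≤ η) (hC : 0 ≤ C) (h : IsRandomSubstitution θ P) (hcl : ConstantLength θ ℓ) :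
    topEntropy θ ≤ η := by
  have hℓ : (1 : ℝ) < ℓ := by exact_mod_cast hcl.1
  have hlim : Tendsto (fun m : ℕ => (Real.log (Fintype.card A) + C) / (ℓ : ℝ) ^ m + η) atTop
      (nhds (0 + η)) :=
    ((tendsto_pow_atTop_atTop_of_one_lt hℓ).const_div_atTop _).add_const η
  rw [zero_add] at hlim
  refine ge_of_tendsto' hlim fun m => ?_
  have hpow : (0 : ℝ) < (ℓ : ℝ) ^ m := by positivity
  set K := Real.log (Fintype.card A) + C + (ℓ : ℝ) ^ m * η with hK
  have hKlim : Tendsto (fun n : ℕ => K / (ℓ : ℝ) ^ m + (m * Real.log ℓ + 2 * K) / (n : ℝ)) atTop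
      (nhds (K / (ℓ : ℝ) ^ m + 0)) :=
    (tendsto_natCast_atTop_atTop.const_div_atTop _).const_add _
  have hle : topEntropy θ ≤ K / (ℓ : ℝ) ^ m + 0 := by
    rw [← hKlim.limsup_eq]
    refine limsup_le_limsup ?_ (isCoboundedUnder_log_card_legalWords θ) hKlim.isBoundedUnder_le
    filter_upwards [eventually_ge_atTop (ℓ ^ m)] with n hn
    have hn0 : (0 : ℝ) < n := by
      exact_mod_cast (pow_pos (by have := hcl.1; omega) m : 0 < ℓ ^ m).trans_le hn
    rw [div_le_iff₀ hn0]
    refine (hB.log_card_legalWords_le hη hC h hcl hn).trans_eq ?_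
    rw [← hK]
    field_simp
    ring
  refine hle.trans_eq ?_
  rw [hK]
  field_simp
  ring

lemma ProbBounds.le_topEntropy [Nonempty A] {η C : ℝ} (hB : ProbBounds θ P ℓ η C)
    (h : IsRandomSubstitution θ P) (hcl : ConstantLength θ ℓ) : η ≤ topEntropy θ := by
  have hℓ : (1 : ℝ) < ℓ := by exact_mod_cast hcl.1
  obtain ⟨b⟩ := ‹Nonempty A›
  have hm (m : ℕ) : η - C / (ℓ : ℝ) ^ m ≤
      Real.log ((legalWords θ (ℓ ^ m)).card) / ((ℓ ^ m : ℕ) : ℝ) := by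
    have hpow : (0 : ℝ) < (ℓ : ℝ) ^ m := by positivity
    have hsub : realsIter θ m [b] ⊆ legalWords θ (ℓ ^ m) := fun w hw =>
      mem_legalWords.2 ⟨by simpa using hcl.length_realsIter hw, legal_of_mem_realsIter hw⟩
    have hcard : Real.exp ((ℓ : ℝ) ^ m * η - C) ≤ (legalWords θ (ℓ ^ m)).card :=
      (hB.le_card h m b).trans (by exact_mod_cast Finset.card_le_card hsub)
    have hlog := (Real.le_log_iff_exp_le ((Real.exp_pos _).trans_le hcard)).2 hcard
    push_cast
    rw [le_div_iff₀ hpow]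
    refine le_trans (le_of_eq ?_) hlog
    field_simp
  have hlim : Tendsto (fun m : ℕ => η - C / (ℓ : ℝ) ^ m) atTop (nhds (η - 0)) :=
    ((tendsto_pow_atTop_atTop_of_one_lt hℓ).const_div_atTop _).const_sub η
  rw [sub_zero] at hlim
  refine le_of_forall_lt fun c hc => lt_of_lt_of_le (exists_between hc).choose_spec.1 ?_
  obtain ⟨-, hc'⟩ := (exists_between hc).choose_spec
  have : Nonempty A := ⟨b⟩
  refine le_limsup_of_frequently_le ?_ (isBoundedUnder_log_card_legalWords θ)
  refine (tendsto_pow_atTop_atTop_of_one_lt hcl.1).frequently ?_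
  exact ((hlim.eventually_const_lt hc').mono fun m h1 => h1.le.trans (hm m)).frequently

end Entropy

section CylinderBounds

variable {θ : A → Finset (List A)} {P : A → List A → ℝ} {ℓ r : ℕ}

lemma occCount_eq_card (v w : List A) :
    occCount v w = ((Finset.range w.length).filter fun i => v <+: w.drop i).card :=
  rfl

lemma occCount_cons (v : List A) (a : A) (w : List A) :
    occCount v (a :: w) = (if v <+: a :: w then 1 else 0) + occCount v w := by
  simp only [occCount_eq_card, Finset.card_filter, List.length_cons]
  rw [Finset.sum_range_succ', add_comm]
  rfl

lemma occCount_le_append (v z₁ z₂ : List A) : occCount v z₂ ≤ occCount v (z₁ ++ z₂) := by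
  induction z₁ with
  | nil => exact le_rfl
  | cons a z ih =>
    rw [List.cons_append, occCount_cons]
    omega

lemma indicator_add_occCount_le {w : List A} (hw : w ≠ []) (z₁ z₂ : List A) :
    (if z₁ = w then 1 else 0) + occCount w z₂ ≤ occCount w (z₁ ++ z₂) := by
  split_ifs with hz
  · obtain ⟨a, t, rfl⟩ := List.exists_cons_of_ne_nil hw
    subst hz
    have hpre : a :: t <+: a :: (t ++ z₂) := List.prefix_append (a :: t) z₂
    rw [List.cons_append, occCount_cons, if_pos hpre]
    exact Nat.add_le_add_left (occCount_le_append _ t z₂) 1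
  · simpa using occCount_le_append w z₁ z₂

lemma iterProb_nonneg (h : IsRandomSubstitution θ P) (n : ℕ) (u w : List A) :
    0 ≤ iterProb θ P n u w := by
  rw [← markov_iterate_indicator]
  refine (markov_iterate_const h n 0 u).ge.trans (markov_iterate_mono h fun x _ => ?_)
  split_ifs <;> simp

lemma count_mul_iterProb_le (h : IsRandomSubstitution θ P) {w : List A} (hw : w ≠ []) (m : ℕ)
    (a : A) (v : List A) :
    iterProb θ P m [a] w * v.count a ≤ (markov θ P)^[m] (fun z => (occCount w z : ℝ)) v := by
  induction v with
  | nil => simp [markov_iterate_nil]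
  | cons b v ih =>
    calc iterProb θ P m [a] w * (b :: v).count a
        ≤ iterProb θ P m [b] w + (markov θ P)^[m] (fun z => (occCount w z : ℝ)) v := by
          rw [List.count_cons]
          by_cases hba : b = a
          · subst hba
            simp only [beq_self_eq_true, if_true]
            push_cast
            linarith
          · have := iterProb_nonneg h m [b] w
            simp only [beq_iff_eq, hba, if_false, add_zero]
            linarith
      _ = (markov θ P)^[m] (fun x => (markov θ P)^[m]
            (fun y => (if x = w then (1 : ℝ) else 0) + (occCount w y : ℝ)) v) [b] := by
          simp only [markov_iterate_add, markov_iterate_const h, markov_iterate_indicator]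
      _ ≤ (markov θ P)^[m] (fun x => (markov θ P)^[m]
            (fun y => (occCount w (x ++ y) : ℝ)) v) [b] := by
          refine markov_iterate_mono h fun x _ => markov_iterate_mono h fun y _ => ?_
          exact_mod_cast indicator_add_occCount_le hw x y
      _ = _ := (markov_iterate_append m (fun z => (occCount w z : ℝ)) [b] v).symm

lemma iterProb_mul_le_expCount (h : IsRandomSubstitution θ P) {w : List A} (hw : w ≠ [])
    (k m : ℕ) (a b : A) :
    iterProb θ P m [a] w * (substM θ P ^ k) a b ≤ expCount θ P (k + m) b w := by
  rw [expCount_eq, Function.iterate_add_apply, ← markov_iterate_count h,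
    ← markov_iterate_const_mul]
  exact markov_iterate_mono h fun v _ => count_mul_iterProb_le h hw m a v

lemma markov_iterate_drop (h : IsRandomSubstitution θ P) (hcl : ConstantLength θ ℓ) (s i : ℕ)
    (F : List A → ℝ) (v : List A) :
    (markov θ P)^[s] (fun z => F (z.drop (ℓ ^ s * i))) v = (markov θ P)^[s] F (v.drop i) := by
  induction i generalizing v with
  | zero => simp
  | succ i ih =>
    cases v with
    | nil => simp [markov_iterate_nil]
    | cons b v =>
      rw [← List.singleton_append, markov_iterate_append,
        markov_iterate_congr h (G := fun _ => (markov θ P)^[s] F (v.drop i)),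
        markov_iterate_const h]
      · simp
      · intro x hx
        have hlen : x.length = ℓ ^ s := by simpa using hcl.length_realsIter hx
        rw [← ih]
        refine markov_iterate_congr h fun y _ => ?_
        rw [mul_add, mul_one, add_comm, ← hlen, List.drop_length_add_append]

lemma markov_iterate_prefix_le (h : IsRandomSubstitution θ P) (hcl : ConstantLength θ ℓ)
    {s : ℕ} {κ : ℝ} (hκ : ∀ (b : A) (x : List A), iterProb θ P s [b] x ≤ κ) {n : ℕ}
    {w : List A} (hw : w.length = ℓ ^ s * n) (hκ0 : 0 ≤ κ) (v : List A) :
    (markov θ P)^[s] (fun z => if w <+: z then 1 else 0) v ≤ κ ^ n := by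
  have hℓ : 0 < ℓ ^ s := pow_pos (by have := hcl.1; omega) s
  induction n generalizing w v with
  | zero =>
    obtain rfl : w = [] := by simpa using hw
    simp [markov_iterate_const h]
  | succ n ih =>
    have hw0 : w ≠ [] := by
      rintro rfl
      simp only [List.length_nil, mul_add] at hw
      omega
    cases v with
    | nil =>
      rw [markov_iterate_nil, if_neg (by simpa using hw0)]
      positivity
    | cons b v =>
      have hdrop : (w.drop (ℓ ^ s)).length = ℓ ^ s * n := by
        rw [List.length_drop, hw, mul_add]
        omega
      calc (markov θ P)^[s] (fun z => if w <+: z then 1 else 0) (b :: v)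
          = (markov θ P)^[s] (fun x => (markov θ P)^[s]
              (fun y => if w <+: x ++ y then 1 else 0) v) [b] :=
            markov_iterate_append s _ [b] v
        _ ≤ (markov θ P)^[s] (fun x => κ ^ n * if x = w.take (ℓ ^ s) then 1 else 0) [b] := by
            refine markov_iterate_mono h fun x hx => ?_
            have hlen : x.length = ℓ ^ s := by simpa using hcl.length_realsIter hx
            split_ifs with hxw
            · rw [mul_one]
              refine (le_of_eq ?_).trans (ih hdrop v)
              refine markov_iterate_congr h fun y _ => ?_
              conv_lhs => rw [← List.take_append_drop (ℓ ^ s) w, ← hxw]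
              simp only [List.prefix_append_right_inj]
            · rw [mul_zero]
              refine (markov_iterate_mono h (G := fun _ => 0) fun y _ => ?_).trans
                (markov_iterate_const h s 0 v).le
              rw [if_neg]
              intro hpre
              refine hxw ?_
              have h1 := (List.take_prefix (ℓ ^ s) w).trans hpre
              have h2 : (w.take (ℓ ^ s)).length = x.length := by
                rw [List.length_take, hw, hlen, mul_add]
                omega
              exact ((List.prefix_of_prefix_length_le h1 (List.prefix_append x y)
                h2.le).eq_of_length h2).symm
        _ = κ ^ n * iterProb θ P s [b] (w.take (ℓ ^ s)) := by
            rw [markov_iterate_const_mul, markov_iterate_indicator]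
        _ ≤ κ ^ n * κ := by gcongr; exact hκ b _
        _ = κ ^ (n + 1) := (pow_succ κ n).symm

lemma LocallyRecognisable.occCount_le (hr : LocallyRecognisable θ ℓ r)
    (hθ : ∀ a, (θ a).Nonempty) (hcl : ConstantLength θ ℓ) {s : ℕ} {u v w z : List A}
    (hu : Legal θ u) (hv : Legal θ v) (hw : w ∈ realsIter θ s u) (hz : z ∈ realsIter θ s v)
    (hw0 : w ≠ []) (hlen : ℓ ^ s * (2 * r + 1) ≤ w.length + 2 * r) :
    occCount w z ≤ ∑ i ∈ Finset.range v.length, if w <+: z.drop (ℓ ^ s * i) then 1 else 0 := by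
  rw [occCount_eq_card, ← Finset.card_filter]
  refine (Finset.card_le_card ?_).trans
    (Finset.card_image_le (f := fun i => ℓ ^ s * i))
  intro i hi
  obtain ⟨hi, hpre⟩ := Finset.mem_filter.1 hi
  have hiz := Finset.mem_range.1 hi
  have hwpos := List.length_pos_iff.2 hw0
  have hle := hpre.length_le
  rw [List.length_drop] at hle
  have hmod : 0 ≡ i [MOD ℓ ^ s] := by
    refine hr.modEq hθ hcl s hu hv hw hz hlen (by omega) (by omega) fun t ht => ?_
    have := List.prefix_iff_getElem?.1 hpre t ht
    rw [zero_add, List.getElem?_eq_getElem ht, ← this, List.getElem?_drop]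
  obtain ⟨q, rfl⟩ := (Nat.modEq_zero_iff_dvd.1 hmod.symm)
  refine Finset.mem_image.2 ⟨q, Finset.mem_filter.2 ⟨Finset.mem_range.2 ?_, hpre⟩, rfl⟩
  rw [hcl.length_realsIter hz] at hiz
  exact lt_of_mul_lt_mul_left hiz (Nat.zero_le _)

lemma LocallyRecognisable.expCount_le (hr : LocallyRecognisable θ ℓ r)
    (h : IsRandomSubstitution θ P) (hcl : ConstantLength θ ℓ) {s n : ℕ} {κ : ℝ}
    (hκ0 : 0 ≤ κ) (hκ : ∀ (b : A) (x : List A), iterProb θ P s [b] x ≤ κ) {u w : List A}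
    (hu : Legal θ u) (hw : w ∈ realsIter θ s u) (hw0 : w ≠ []) (hn : w.length = ℓ ^ s * n)
    (hlen : ℓ ^ s * (2 * r + 1) ≤ w.length + 2 * r) (k : ℕ) (b : A) :
    expCount θ P (k + s) b w ≤ (ℓ : ℝ) ^ k * κ ^ n := by
  have hlegal (v : List A) (hv : Legal θ v) :
      (markov θ P)^[s] (fun z => (occCount w z : ℝ)) v ≤ v.length * κ ^ n := by
    calc (markov θ P)^[s] (fun z => (occCount w z : ℝ)) v
        ≤ (markov θ P)^[s] (fun z => ∑ i ∈ Finset.range v.length,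
            1 * if w <+: z.drop (ℓ ^ s * i) then 1 else 0) v := by
          refine markov_iterate_mono h fun z hz => ?_
          simp only [one_mul]
          exact_mod_cast hr.occCount_le h.1 hcl hu hv hw hz hw0 hlen
      _ = ∑ i ∈ Finset.range v.length, 1 *
            (markov θ P)^[s] (fun z => if w <+: z then 1 else 0) (v.drop i) := by
          rw [markov_iterate_sum]
          refine Finset.sum_congr rfl fun i _ => ?_
          rw [markov_iterate_drop h hcl s i fun z => if w <+: z then 1 else 0]
      _ ≤ ∑ _i ∈ Finset.range v.length, κ ^ n := Finset.sum_le_sum fun i _ => by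
          rw [one_mul]
          exact markov_iterate_prefix_le h hcl hκ hn hκ0 _
      _ = v.length * κ ^ n := by simp
  rw [expCount_eq, Function.iterate_add_apply,
    ← markov_iterate_const h k ((ℓ : ℝ) ^ k * κ ^ n) [b]]
  refine markov_iterate_mono h fun v hv => (hlegal v (legal_of_mem_realsIter hv)).trans_eq ?_
  simp [hcl.length_realsIter hv]

end CylinderBounds

theorem statement19 {A : Type*} [Fintype A] [DecidableEq A] [MeasurableSpace A]
    (θ : A → Finset (List A)) (P : A → List A → ℝ) (ℓ : ℕ) (μ : Measure (ℤ → A))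
    (hRS : IsRandomSubstitution θ P) (hprim : IsPrimitive θ P)
    (hcl : ConstantLength θ ℓ) (hrec : Recognisable θ)
    (hcase : (∀ a b : A, (θ a).card = (θ b).card) ∨
      (Compatible θ ∧
        ∀ z ∈ spectrum ℂ ((substM θ P).map Complex.ofReal), z = 0 ∨ z = (ℓ : ℂ)))
    (hunif : ∀ a : A, ∀ s ∈ θ a, P a s = ((θ a).card : ℝ)⁻¹)
    (hμ : IsFrequencyMeasure θ P μ) :
    ∃ c₁ c₂ : ℝ, 0 < c₁ ∧ 0 < c₂ ∧
      ∀ (a : A) (m : ℕ), 1 ≤ m → ∀ w ∈ realsIter θ m [a],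
        c₁ / (w.length : ℝ) * Real.exp (-(w.length : ℝ) * topEntropy θ) ≤
            (μ (cylinder w 0)).toReal ∧
          (μ (cylinder w 0)).toReal ≤
            c₂ / (w.length : ℝ) * Real.exp (-(w.length : ℝ) * topEntropy θ) := by
  rcases isEmpty_or_nonempty A with hA | hA
  · exact ⟨1, 1, one_pos, one_pos, fun a => isEmptyElim a⟩
  obtain ⟨d⟩ := id hA
  obtain ⟨r, hr⟩ : ∃ r, LocallyRecognisable θ ℓ r :=
    exists_recognisability_radius hRS.1 hcl hrec d
  obtain ⟨η, C, hη, hC, hB⟩ := hr.exists_probBounds hRS hcl hprim hcase hunif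
  obtain ⟨δ, hδ, k₀, hk₀⟩ := exists_le_substM_pow hRS hcl hprim
  rw [le_antisymm (hB.topEntropy_le hη hC hRS hcl) (hB.le_topEntropy hRS hcl)]
  have hℓ1 : (1 : ℝ) < ℓ := by exact_mod_cast hcl.1
  have hℓ0 : (0 : ℝ) < ℓ := one_pos.trans hℓ1
  obtain ⟨j, hj⟩ : ∃ j, j = 2 * r + 1 := ⟨_, rfl⟩
  refine ⟨δ * Real.exp (-C), (ℓ : ℝ) ^ j * Real.exp ((ℓ : ℝ) ^ j * (C + η)), by positivity,
    by positivity, fun a m _ w hw => ?_⟩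
  have hlen : w.length = ℓ ^ m := by simpa using hcl.length_realsIter hw
  have hw0 : w ≠ [] := by
    rw [← List.length_pos_iff, hlen]
    exact pow_pos (by have := hcl.1; omega) m
  have hlim (s : ℕ) : Tendsto (fun k : ℕ => expCount θ P (k + s) d w / (ℓ : ℝ) ^ (k + s)) atTop
      (nhds ((μ (cylinder w 0)).toReal)) := by
    have := (hμ.2.2.2 w (legal_of_mem_realsIter hw) 0 d).comp (tendsto_add_atTop_nat s)
    simpa only [Function.comp_def, expLen_eq hRS hcl] using this
  rw [hlen]
  push_cast
  constructor
  · refine ge_of_tendsto (hlim m) ?_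
    filter_upwards [eventually_ge_atTop k₀] with k hk
    rw [le_div_iff₀ (by positivity)]
    calc δ * Real.exp (-C) / (ℓ : ℝ) ^ m * Real.exp (-(ℓ : ℝ) ^ m * η) * (ℓ : ℝ) ^ (k + m)
        = Real.exp (-C - (ℓ : ℝ) ^ m * η) * (δ * (ℓ : ℝ) ^ k) := by
          rw [sub_eq_add_neg, Real.exp_add, ← neg_mul, pow_add]
          field_simp
      _ ≤ iterProb θ P m [a] w * (substM θ P ^ k) a d :=
          mul_le_mul (hB m a w hw).1 (hk₀ k hk a d) (by positivity) (iterProb_nonneg hRS m _ w)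
      _ ≤ _ := iterProb_mul_le_expCount hRS hw0 k m a d
  · rcases le_or_gt j m with hjm | hjm
    · obtain ⟨s, rfl⟩ := Nat.exists_eq_add_of_le hjm
      obtain ⟨u, hu, hwu⟩ := mem_realsIter_add.1 hw
      have hκ (b : A) (x : List A) :
          iterProb θ P s [b] x ≤ Real.exp (C - (ℓ : ℝ) ^ s * η) := by
        by_cases hx : x ∈ realsIter θ s [b]
        · exact (hB s b x hx).2
        · rw [iterProb_eq_zero hx]
          positivity
      have hwj : w.length = ℓ ^ s * ℓ ^ j := by rw [hlen, pow_add, mul_comm]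
      have hjr : 2 * r + 1 ≤ ℓ ^ j := hj ▸ (Nat.lt_pow_self hcl.1).le
      refine le_of_tendsto' (hlim s) fun k => ?_
      rw [div_le_iff₀ (by positivity)]
      refine (hr.expCount_le hRS hcl (Real.exp_pos _).le hκ (legal_of_mem_realsIter hu) hwu hw0
        hwj ?_ k d).trans ?_
      · rw [hwj]
        exact (Nat.mul_le_mul_left _ hjr).trans (Nat.le_add_right _ _)
      · have hexp : Real.exp (C - (ℓ : ℝ) ^ s * η) ^ ℓ ^ j =
            Real.exp ((ℓ : ℝ) ^ j * C) * Real.exp (-(ℓ : ℝ) ^ (j + s) * η) := by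
          rw [← Real.exp_nat_mul, ← Real.exp_add, pow_add]
          congr 1
          push_cast
          ring
        calc (ℓ : ℝ) ^ k * Real.exp (C - (ℓ : ℝ) ^ s * η) ^ ℓ ^ j
            = (ℓ : ℝ) ^ j * Real.exp ((ℓ : ℝ) ^ j * C) / (ℓ : ℝ) ^ (j + s) *
                Real.exp (-(ℓ : ℝ) ^ (j + s) * η) * (ℓ : ℝ) ^ (k + s) := by
              rw [hexp, pow_add _ k s, pow_add _ j s]
              field_simp
          _ ≤ _ := by
              gcongr
              linarith
    · have hprob := hμ.1
      have hpow : (ℓ : ℝ) ^ m ≤ (ℓ : ℝ) ^ j := pow_le_pow_right₀ hℓ1.le hjm.le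
      calc (μ (cylinder w 0)).toReal ≤ 1 := measureReal_le_one
        _ ≤ ((ℓ : ℝ) ^ j / (ℓ : ℝ) ^ m) *
              Real.exp ((ℓ : ℝ) ^ j * (C + η) + -(ℓ : ℝ) ^ m * η) := by
            refine one_le_mul_of_one_le_of_one_le ((one_le_div (by positivity)).2 hpow)
              (Real.one_le_exp ?_)
            nlinarith [mul_nonneg (sub_nonneg.2 hpow) hη, mul_nonneg (pow_pos hℓ0 j).le hC]
        _ = _ := by
            rw [Real.exp_add]
            ring

end RandomSubstitutionTheory
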